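/- Let n = 2m ≥ 4 be an even integer and B_1 the open unit ball in ℝ^n. Suppose K ∈ L^∞(B_1) is nonnegative and u ∈ C^{2m}(B_1 \ {0}) solves (−Δ)^m u = K(x) e^u in B_1 \ {0}, with ∫_{B_1 \ {0}} e^{u(x)} dx < ∞ and ∫_{B_r \ {0}} |u(x)| dx = o(r^{2m−2}) as r → 0. Then there exist a constant α > −2m, an exponent γ ∈ (0,1), and a function φ that is γ-Hölder continuous on a neighborhood of the origin, such that u(x) = α ln|x| + φ(x) for all x ≠ 0 in that neighborhood. -/

import Mathlib

open MeasureTheory Metric Real Set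
open scoped ENNReal NNReal

noncomputable section

/-- First-order partial derivative in direction `i`. -/
def pderiv1 {n : ℕ} (i : Fin n) (f : EuclideanSpace ℝ (Fin n) → ℝ) :
    EuclideanSpace ℝ (Fin n) → ℝ :=
  fun x => fderiv ℝ f x (EuclideanSpace.single i 1)

/-- The Laplacian `Δf = ∑ ∂²f/∂xᵢ²`. -/
def lap {n : ℕ} (f : EuclideanSpace ℝ (Fin n) → ℝ) : EuclideanSpace ℝ (Fin n) → ℝ :=
  fun x => ∑ i, pderiv1 i (pderiv1 i f) x

/-- The negative Laplacian `-Δ`. -/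
def nlap {n : ℕ} (f : EuclideanSpace ℝ (Fin n) → ℝ) : EuclideanSpace ℝ (Fin n) → ℝ :=
  fun x => -(lap f x)

/-- `(-Δ)^m`, the m-th iterate of the negative Laplacian. -/
def nlapIter {n : ℕ} (m : ℕ) (f : EuclideanSpace ℝ (Fin n) → ℝ) :
    EuclideanSpace ℝ (Fin n) → ℝ :=
  nlap^[m] f

/-- `D^β`, the mixed partial derivative associated to a multi-index `β`. -/
def mderiv {n : ℕ} (β : Fin n → ℕ) (f : EuclideanSpace ℝ (Fin n) → ℝ) :
    EuclideanSpace ℝ (Fin n) → ℝ :=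
  ((List.finRange n).foldr (fun i F => F ∘ (pderiv1 i)^[β i]) id) f

/-- The finset of multi-indices `β` with `|β| ≤ s`. -/
def degLE (n s : ℕ) : Finset (Fin n → ℕ) :=
  (Fintype.piFinset fun _ : Fin n => Finset.range (s+1)).filter fun β => ∑ i, β i ≤ s

/-- The finset of multi-indices `β` with `|β| < s` (i.e. `|β| ≤ s - 1`; empty for `s = 0`). -/
def degLT (n s : ℕ) : Finset (Fin n → ℕ) :=
  (Fintype.piFinset fun _ : Fin n => Finset.range s).filter fun β => ∑ i, β i < s

/-- Fundamental-solution profile of `(-Δ)^m` on `ℝⁿ`: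
`c‖x‖^{2m-n}` for `n > 2m` and `c ln(5/‖x‖)` for `n = 2m`. -/
def fundSol (m n : ℕ) (c : ℝ) : EuclideanSpace ℝ (Fin n) → ℝ :=
  fun x => if n = 2*m then c * Real.log (5 / ‖x‖) else c * ‖x‖ ^ ((2*m : ℤ) - n)

/-- `ψ(x,y) = φ(x-y) - ∑_{|β| ≤ s-1} ((-y)^β/β!) D^β φ(x)`. -/
def psiFun (m n s : ℕ) (c : ℝ) (x y : EuclideanSpace ℝ (Fin n)) : ℝ :=
  fundSol m n c (x - y) -
    ∑ β ∈ degLT n s,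
      ((∏ i, (-(y i)) ^ β i) / ∏ i, ((β i).factorial : ℝ)) * mderiv β (fundSol m n c) x

/-- `N(x) = ∫_{|y| ≤ 1} ψ(x,y) f(y) dy`. -/
def NFun (m n s : ℕ) (c : ℝ) (f : EuclideanSpace ℝ (Fin n) → ℝ)
    (x : EuclideanSpace ℝ (Fin n)) : ℝ :=
  ∫ y in closedBall (0 : EuclideanSpace ℝ (Fin n)) 1, psiFun m n s c x y * f y

section Singularity

open Filter Topology
open scoped ContDiff

section Calculus

variable {n : ℕ} {f g : EuclideanSpace ℝ (Fin n) → ℝ} {x : EuclideanSpace ℝ (Fin n)}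

lemma pderiv1_eventuallyEq (i : Fin n) (h : f =ᶠ[𝓝 x] g) : pderiv1 i f =ᶠ[𝓝 x] pderiv1 i g := by
  filter_upwards [h.fderiv (𝕜 := ℝ)] with y hy
  simp [pderiv1, hy]

lemma nlap_eventuallyEq (h : f =ᶠ[𝓝 x] g) : nlap f =ᶠ[𝓝 x] nlap g := by
  have : ∀ i, pderiv1 i (pderiv1 i f) =ᶠ[𝓝 x] pderiv1 i (pderiv1 i g) := fun i =>
    pderiv1_eventuallyEq i (pderiv1_eventuallyEq i h)
  filter_upwards [eventually_all.2 this] with y hy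
  simp [nlap, lap, hy]

lemma nlapIter_succ (k : ℕ) (f : EuclideanSpace ℝ (Fin n) → ℝ) :
    nlapIter (k + 1) f = nlap (nlapIter k f) := by
  simp [nlapIter, Function.iterate_succ_apply']

lemma nlapIter_eventuallyEq (k : ℕ) (h : f =ᶠ[𝓝 x] g) :
    nlapIter k f =ᶠ[𝓝 x] nlapIter k g := by
  induction k with
  | zero => simpa [nlapIter] using h
  | succ k ih => simpa [nlapIter_succ] using nlap_eventuallyEq ih

lemma contDiffAt_pderiv1 {k l : WithTop ℕ∞} (i : Fin n) (hf : ContDiffAt ℝ l f x)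
    (hkl : k + 1 ≤ l) : ContDiffAt ℝ k (pderiv1 i f) x :=
  (hf.fderiv_right hkl).clm_apply contDiffAt_const

lemma contDiffAt_nlap {k l : WithTop ℕ∞} (hf : ContDiffAt ℝ l f x) (hkl : k + 2 ≤ l) :
    ContDiffAt ℝ k (nlap f) x := by
  have h2 : k + 1 + 1 ≤ l := by rwa [add_assoc, one_add_one_eq_two]
  exact (ContDiffAt.sum fun i _ =>
    contDiffAt_pderiv1 i (contDiffAt_pderiv1 i hf h2) le_rfl).neg

lemma contDiffAt_nlapIter {k : ℕ} (j : ℕ) (hf : ContDiffAt ℝ ((k + 2 * j : ℕ)) f x) :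
    ContDiffAt ℝ k (nlapIter j f) x := by
  induction j generalizing k with
  | zero => simpa [nlapIter] using hf
  | succ j ih =>
    rw [nlapIter_succ]
    refine contDiffAt_nlap (l := ((k + 2 : ℕ))) (ih (hf.of_le ?_)) (by simp)
    exact_mod_cast (by omega)

lemma contDiff_nlapIter {k : ℕ} (j : ℕ) (hf : ContDiff ℝ ((k + 2 * j : ℕ)) f) :
    ContDiff ℝ k (nlapIter j f) :=
  contDiff_iff_contDiffAt.2 fun _ => contDiffAt_nlapIter j hf.contDiffAt

lemma contDiff_infty_nlapIter (j : ℕ) (hf : ContDiff ℝ ∞ f) : ContDiff ℝ ∞ (nlapIter j f) :=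
  contDiff_infty.2 fun _ => hf.of_le (WithTop.coe_le_coe.2 le_top) |> contDiff_nlapIter j

lemma norm_iteratedFDeriv_pderiv1_le (i : Fin n) (k : ℕ)
    (hf : ContDiffAt ℝ ((k + 1 : ℕ)) f x) :
    ‖iteratedFDeriv ℝ k (pderiv1 i f) x‖ ≤ ‖iteratedFDeriv ℝ (k + 1) f x‖ := by
  have h := norm_iteratedFDeriv_clm_apply_const (f := fderiv ℝ f) (n := k) (N := k)
    (c := EuclideanSpace.single i (1 : ℝ)) (hf.fderiv_right (by simp)) le_rfl
  rw [norm_iteratedFDeriv_fderiv] at h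
  simpa [pderiv1, Function.comp_def] using! h

lemma norm_iteratedFDeriv_nlap_le (k : ℕ) (hf : ContDiff ℝ ((k + 2 : ℕ)) f) :
    ‖iteratedFDeriv ℝ k (nlap f) x‖ ≤ n * ‖iteratedFDeriv ℝ (k + 2) f x‖ := by
  have hf2 (i : Fin n) (y) : ContDiffAt ℝ k (pderiv1 i (pderiv1 i f)) y :=
    contDiffAt_pderiv1 i (contDiffAt_pderiv1 (k := ((k + 1 : ℕ))) i hf.contDiffAt
      (by norm_cast)) (by norm_cast)
  have h1 : nlap f = -(fun y => ∑ i, pderiv1 i (pderiv1 i f) y) := rfl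
  rw [h1, iteratedFDeriv_neg, Pi.neg_apply, norm_neg,
    iteratedFDeriv_sum (fun i _ => contDiff_iff_contDiffAt.2 (hf2 i)), Finset.sum_apply]
  refine (norm_sum_le _ _).trans ?_
  calc _ ≤ ∑ _i : Fin n, ‖iteratedFDeriv ℝ (k + 2) f x‖ := Finset.sum_le_sum fun i _ =>
        (norm_iteratedFDeriv_pderiv1_le i k (contDiffAt_pderiv1 i hf.contDiffAt
          (by norm_cast))).trans
          (norm_iteratedFDeriv_pderiv1_le i (k + 1) hf.contDiffAt)
    _ = _ := by simp

lemma norm_iteratedFDeriv_nlapIter_le (j k : ℕ) (hf : ContDiff ℝ ((k + 2 * j : ℕ)) f) :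
    ‖iteratedFDeriv ℝ k (nlapIter j f) x‖ ≤ n ^ j * ‖iteratedFDeriv ℝ (k + 2 * j) f x‖ := by
  induction j generalizing k with
  | zero => simp [nlapIter]
  | succ j ih =>
    rw [nlapIter_succ]
    have e : k + 2 + 2 * j = k + 2 * (j + 1) := by ring
    have h := ih (k + 2) (by rwa [e])
    rw [e] at h
    refine (norm_iteratedFDeriv_nlap_le k (contDiff_nlapIter j (by rwa [e]))).trans ?_
    calc _ ≤ (n : ℝ) * (n ^ j * ‖iteratedFDeriv ℝ (k + 2 * (j + 1)) f x‖) := by gcongr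
      _ = _ := by ring

lemma abs_nlapIter_le (j : ℕ) (hf : ContDiff ℝ ((2 * j : ℕ)) f) :
    |nlapIter j f x| ≤ n ^ j * ‖iteratedFDeriv ℝ (2 * j) f x‖ := by
  have h := norm_iteratedFDeriv_nlapIter_le (x := x) j 0 (f := f) (by simpa using hf)
  rw [zero_add] at h
  simpa using h

lemma pderiv1_add (i : Fin n) (hf : ContDiff ℝ 1 f) (hg : ContDiff ℝ 1 g) :
    pderiv1 i (f + g) = pderiv1 i f + pderiv1 i g := by
  ext y
  simp [pderiv1, fderiv_add (hf.differentiable one_ne_zero y) (hg.differentiable one_ne_zero y)]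

lemma contDiff_infty_pderiv1 (i : Fin n) (hf : ContDiff ℝ ∞ f) : ContDiff ℝ ∞ (pderiv1 i f) :=
  contDiff_iff_contDiffAt.2 fun _ => contDiffAt_pderiv1 i hf.contDiffAt (by simp)

lemma pderiv1_const_smul (i : Fin n) (c : ℝ) (hf : ContDiff ℝ 1 f) :
    pderiv1 i (c • f) = c • pderiv1 i f := by
  ext y
  simp [pderiv1, fderiv_const_smul (hf.differentiable one_ne_zero y)]

lemma nlap_add (hf : ContDiff ℝ ∞ f) (hg : ContDiff ℝ ∞ g) :
    nlap (f + g) = nlap f + nlap g := by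
  have h (i : Fin n) : pderiv1 i (pderiv1 i (f + g)) =
      pderiv1 i (pderiv1 i f) + pderiv1 i (pderiv1 i g) := by
    rw [pderiv1_add i (hf.of_le (by simp)) (hg.of_le (by simp)), pderiv1_add i
      ((contDiff_infty_pderiv1 i hf).of_le (by simp))
      ((contDiff_infty_pderiv1 i hg).of_le (by simp))]
  ext y
  simp [nlap, lap, h, Finset.sum_add_distrib, add_comm]

lemma nlap_const_smul (c : ℝ) (hf : ContDiff ℝ ∞ f) : nlap (c • f) = c • nlap f := by
  have h (i : Fin n) : pderiv1 i (pderiv1 i (c • f)) = c • pderiv1 i (pderiv1 i f) := by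
    rw [pderiv1_const_smul i c (hf.of_le (by simp)), pderiv1_const_smul i c
      ((contDiff_infty_pderiv1 i hf).of_le (by simp))]
  ext y
  simp [nlap, lap, h, Finset.mul_sum]

lemma nlapIter_add (k : ℕ) (hf : ContDiff ℝ ∞ f) (hg : ContDiff ℝ ∞ g) :
    nlapIter k (f + g) = nlapIter k f + nlapIter k g := by
  induction k with
  | zero => rfl
  | succ k ih =>
    rw [nlapIter_succ, ih, nlap_add (contDiff_infty_nlapIter k hf) (contDiff_infty_nlapIter k hg)]
    simp [nlapIter_succ]

lemma nlapIter_const_smul (k : ℕ) (c : ℝ) (hf : ContDiff ℝ ∞ f) :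
    nlapIter k (c • f) = c • nlapIter k f := by
  induction k with
  | zero => rfl
  | succ k ih =>
    rw [nlapIter_succ, ih, nlap_const_smul c (contDiff_infty_nlapIter k hf), nlapIter_succ]

lemma nlapIter_sub (k : ℕ) (hf : ContDiff ℝ ∞ f) (hg : ContDiff ℝ ∞ g) :
    nlapIter k (f - g) = nlapIter k f - nlapIter k g := by
  rw [sub_eq_add_neg, ← neg_one_smul ℝ g,
    nlapIter_add (g := (-1 : ℝ) • g) k hf (hg.const_smul (-1 : ℝ)),
    nlapIter_const_smul k _ hg, neg_one_smul, sub_eq_add_neg]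

/-- Polyharmonic operators of positive order annihilate affine functions. -/
lemma nlapIter_affine {k : ℕ} (hk : 1 ≤ k) (a : ℝ) (L : EuclideanSpace ℝ (Fin n) →L[ℝ] ℝ) :
    nlapIter k (fun y => a + L y) = 0 := by
  have h1 (i : Fin n) : pderiv1 i (fun y => a + L y) = fun _ => L (EuclideanSpace.single i 1) := by
    ext y
    simp [pderiv1, fderiv_const_add]
  have h0 (i : Fin n) (c : ℝ) : pderiv1 i (fun _ => c) = 0 := by
    ext y
    simp [pderiv1]
  have hl : nlap (fun y => a + L y) = 0 := by
    ext y
    simp [nlap, lap, h1, h0]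
  have hz : nlap (0 : EuclideanSpace ℝ (Fin n) → ℝ) = 0 := by
    have h0' (i : Fin n) := h0 i 0
    ext y
    simp only [Pi.zero_def] at h0' ⊢
    simp [nlap, lap, h0']
  induction k, hk using Nat.le_induction with
  | base => simpa [nlapIter] using hl
  | succ k _ ih => rw [nlapIter_succ, ih, hz]

lemma tsupport_pderiv1_subset (i : Fin n) : tsupport (pderiv1 i f) ⊆ tsupport f := by
  refine closure_minimal (fun y hy => ?_) (isClosed_tsupport f)
  refine support_fderiv_subset ℝ fun h => hy ?_
  simp [pderiv1, h]

lemma tsupport_nlap_subset : tsupport (nlap f) ⊆ tsupport f := by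
  refine closure_minimal (fun y hy => ?_) (isClosed_tsupport f)
  by_contra hc
  have h0 (i : Fin n) : pderiv1 i (pderiv1 i fun _ => (0 : ℝ)) = 0 := by
    ext z
    have : pderiv1 i (fun _ : EuclideanSpace ℝ (Fin n) => (0 : ℝ)) = fun _ => 0 := by
      ext z
      simp [pderiv1]
    rw [this]
    simp [pderiv1]
  have : f =ᶠ[𝓝 y] fun _ => 0 := notMem_tsupport_iff_eventuallyEq.1 hc
  have h2 := (nlap_eventuallyEq this).eq_of_nhds
  exact hy (h2.trans (by simp [nlap, lap, h0]))

lemma tsupport_nlapIter_subset (k : ℕ) : tsupport (nlapIter k f) ⊆ tsupport f := by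
  induction k with
  | zero => exact subset_rfl
  | succ k ih => rw [nlapIter_succ]; exact tsupport_nlap_subset.trans ih

lemma integrable_mul_of_hasCompactSupport (hf : Continuous f) (hg : Continuous g)
    (hc : HasCompactSupport f) : Integrable (fun x => f x * g x) :=
  (hf.mul hg).integrable_of_hasCompactSupport hc.mul_right

lemma integral_mul_pderiv1 (i : Fin n) (hf : ContDiff ℝ 1 f) (hg : ContDiff ℝ 1 g)
    (hc : HasCompactSupport f) : ∫ x, f x * pderiv1 i g x = -∫ x, pderiv1 i f x * g x := by
  have hf' : Continuous (pderiv1 i f) :=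
      (hf.continuous_fderiv one_ne_zero).clm_apply continuous_const
  have hg' : Continuous (pderiv1 i g) :=
      (hg.continuous_fderiv one_ne_zero).clm_apply continuous_const
  exact integral_mul_fderiv_eq_neg_fderiv_mul_of_integrable
    (integrable_mul_of_hasCompactSupport hf' hg.continuous
      (hc.of_isClosed_subset (isClosed_tsupport _) (tsupport_pderiv1_subset i)))
    (integrable_mul_of_hasCompactSupport hf.continuous hg' hc)
    (integrable_mul_of_hasCompactSupport hf.continuous hg.continuous hc)
    (fun x _ => hf.differentiable one_ne_zero x) (fun x _ => hg.differentiable one_ne_zero x)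

lemma integral_mul_nlap (hf : ContDiff ℝ 2 f) (hg : ContDiff ℝ 2 g)
    (hc : HasCompactSupport f) : ∫ x, f x * nlap g x = ∫ x, nlap f x * g x := by
  have hp {h : EuclideanSpace ℝ (Fin n) → ℝ} (hh : ContDiff ℝ 2 h) (i : Fin n) :
      ContDiff ℝ 1 (pderiv1 i h) :=
    contDiff_iff_contDiffAt.2 fun y => contDiffAt_pderiv1 i hh.contDiffAt (by norm_num)
  have hpp {h : EuclideanSpace ℝ (Fin n) → ℝ} (hh : ContDiff ℝ 2 h) (i : Fin n) :
      Continuous (pderiv1 i (pderiv1 i h)) :=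
    ((hp hh i).continuous_fderiv one_ne_zero).clm_apply continuous_const
  have hci (i : Fin n) : HasCompactSupport (pderiv1 i f) :=
    hc.of_isClosed_subset (isClosed_tsupport _) (tsupport_pderiv1_subset i)
  have hcii (i : Fin n) : HasCompactSupport (pderiv1 i (pderiv1 i f)) :=
    (hci i).of_isClosed_subset (isClosed_tsupport _) (tsupport_pderiv1_subset i)
  have key (i : Fin n) : ∫ x, f x * pderiv1 i (pderiv1 i g) x =
      ∫ x, pderiv1 i (pderiv1 i f) x * g x := by
    rw [integral_mul_pderiv1 i (hf.of_le one_le_two) (hp hg i) hc,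
      integral_mul_pderiv1 i (hp hf i) (hg.of_le one_le_two) (hci i), neg_neg]
  simp only [nlap, lap, mul_neg, neg_mul, Finset.mul_sum, Finset.sum_mul, integral_neg]
  rw [integral_finsetSum _ fun i _ =>
      integrable_mul_of_hasCompactSupport hf.continuous (hpp hg i) hc,
    integral_finsetSum _ fun i _ =>
      integrable_mul_of_hasCompactSupport (hpp hf i) hg.continuous (hcii i)]
  simp [key]

lemma nlapIter_succ' (k : ℕ) (f : EuclideanSpace ℝ (Fin n) → ℝ) :
    nlapIter (k + 1) f = nlapIter k (nlap f) := by
  simp [nlapIter]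

/-- Green's identity for the polyharmonic operator. -/
lemma integral_mul_nlapIter (k : ℕ) (hf : ContDiff ℝ ((2 * k : ℕ)) f)
    (hg : ContDiff ℝ ((2 * k : ℕ)) g)
    (hc : HasCompactSupport f) : ∫ x, f x * nlapIter k g x = ∫ x, nlapIter k f x * g x := by
  induction k generalizing f g with
  | zero => simp [nlapIter]
  | succ k ih =>
    have e : (2 : WithTop ℕ∞) ≤ ((2 * (k + 1) : ℕ)) := by exact_mod_cast (by omega)
    have e2 : 2 + 2 * k = 2 * (k + 1) := by ring
    have e3 : (((2 * k : ℕ)) : WithTop ℕ∞) + 2 ≤ ((2 * (k + 1) : ℕ)) := by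
      exact_mod_cast (by omega)
    rw [nlapIter_succ, integral_mul_nlap (hf.of_le e)
      (contDiff_nlapIter (k := 2) k (by rwa [e2])) hc, ih
      (contDiff_iff_contDiffAt.2 fun y => contDiffAt_nlap hf.contDiffAt e3)
      (hg.of_le (by exact_mod_cast (by omega)))
      (hc.of_isClosed_subset (isClosed_tsupport _) tsupport_nlap_subset), nlapIter_succ']

end Calculus

section LogKernel

variable {n : ℕ}

lemma pderiv1_comp_norm_sq {h h' : ℝ → ℝ} {t : ℝ} (ht : 0 < t)
    (hh : ∀ r > 0, HasDerivAt h (h' r) r) (x : EuclideanSpace ℝ (Fin n)) (i : Fin n) :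
    pderiv1 i (fun y => h (‖y - x‖ ^ 2 + t)) =
      fun y => 2 * (y i - x i) * h' (‖y - x‖ ^ 2 + t) := by
  ext y
  have h1 : HasFDerivAt (fun y : EuclideanSpace ℝ (Fin n) => ‖y - x‖ ^ 2 + t)
      (2 • (innerSL ℝ (y - x))) y := by
    simpa using! (((hasFDerivAt_id y).sub_const x).norm_sq).add_const t
  have h2 := (hh (‖y - x‖ ^ 2 + t) (by positivity)).comp_hasFDerivAt y h1
  have h3 : pderiv1 i (fun y => h (‖y - x‖ ^ 2 + t)) y =
      (h' (‖y - x‖ ^ 2 + t) • (2 • (innerSL ℝ (y - x)))) (EuclideanSpace.single i 1) := by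
    rw [← h2.fderiv]; rfl
  rw [h3]
  simp [EuclideanSpace.inner_single_right]
  ring

lemma nlap_comp_norm_sq {h h' h'' : ℝ → ℝ} {t : ℝ} (ht : 0 < t)
    (hh : ∀ r > 0, HasDerivAt h (h' r) r) (hh' : ∀ r > 0, HasDerivAt h' (h'' r) r)
    (x y : EuclideanSpace ℝ (Fin n)) :
    nlap (fun y => h (‖y - x‖ ^ 2 + t)) y =
      -(2 * n * h' (‖y - x‖ ^ 2 + t) + 4 * ‖y - x‖ ^ 2 * h'' (‖y - x‖ ^ 2 + t)) := by
  have key (i : Fin n) : pderiv1 i (pderiv1 i (fun y => h (‖y - x‖ ^ 2 + t))) y =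
      2 * h' (‖y - x‖ ^ 2 + t) + 4 * (y i - x i) ^ 2 * h'' (‖y - x‖ ^ 2 + t) := by
    rw [pderiv1_comp_norm_sq ht hh]
    have h1 : HasFDerivAt (fun y : EuclideanSpace ℝ (Fin n) => ‖y - x‖ ^ 2 + t)
        (2 • (innerSL ℝ (y - x))) y := by
      simpa using! (((hasFDerivAt_id y).sub_const x).norm_sq).add_const t
    have h2 := (hh' (‖y - x‖ ^ 2 + t) (by positivity)).comp_hasFDerivAt y h1
    have h4 : HasFDerivAt (fun y : EuclideanSpace ℝ (Fin n) => 2 * (y i - x i))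
        ((2 : ℝ) • (EuclideanSpace.proj i : EuclideanSpace ℝ (Fin n) →L[ℝ] ℝ)) y :=
      (((EuclideanSpace.proj i : EuclideanSpace ℝ (Fin n) →L[ℝ] ℝ).hasFDerivAt).sub_const
        (x i)).const_mul 2
    have h5 := h4.mul h2
    simp only [pderiv1]
    refine (congrArg (fun L : EuclideanSpace ℝ (Fin n) →L[ℝ] ℝ => L (EuclideanSpace.single i 1))
      h5.fderiv).trans ?_
    simp [EuclideanSpace.inner_single_right]
    ring
  have hsum : ∑ i, (y i - x i) ^ 2 = ‖y - x‖ ^ 2 := by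
    simp [EuclideanSpace.norm_sq_eq]
  simp only [nlap, lap, key, Finset.sum_add_distrib, ← Finset.sum_mul, ← Finset.mul_sum, hsum,
    Finset.sum_const, Finset.card_univ, Fintype.card_fin, nsmul_eq_mul]
  ring

lemma hasDerivAt_inv_pow (p : ℕ) {r : ℝ} (hr : 0 < r) :
    HasDerivAt (fun r : ℝ => (r⁻¹) ^ p) (-p * (r⁻¹) ^ (p + 1)) r := by
  have h := (hasDerivAt_inv hr.ne').pow p
  refine h.congr_deriv ?_
  rcases p with _ | p
  · simp
  · simp
    ring

/-- Coefficients of the iterated Laplacians of `log (‖y - x‖ ^ 2 + t)` in dimension `2 * m`. -/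
def logCoeff (m k j : ℕ) : ℝ :=
  2 ^ (2 * k + 1) * (k + 1).choose j * (k + j).factorial *
    ∏ i ∈ Finset.Ico (j + 1) (k + 2), ((m : ℝ) - i)

lemma logCoeff_succ_zero (m k : ℕ) :
    logCoeff m (k + 1) 0 = 4 * (k + 1) * (m - (k + 2)) * logCoeff m k 0 := by
  simp only [logCoeff]
  rw [Finset.prod_Ico_succ_top (by omega)]
  simp [Nat.factorial_succ]
  ring

lemma logCoeff_succ_succ {m k j : ℕ} (hj : j ≤ k + 1) :
    logCoeff m (k + 1) (j + 1) = 4 * (k + j + 2) * (m - (k + j + 3)) * logCoeff m k (j + 1) +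
      4 * (k + j + 1) * (k + j + 2) * logCoeff m k j := by
  simp only [logCoeff]
  rcases hj.eq_or_lt with rfl | hj
  · simp only [Nat.choose_self, Nat.choose_succ_self]
    have : (k + 1 + (k + 1 + 1)).factorial = (2 * k + 3) * (2 * k + 2) * (k + (k + 1)).factorial := by
      rw [show k + 1 + (k + 1 + 1) = (k + (k + 1)) + 1 + 1 by ring, Nat.factorial_succ,
        Nat.factorial_succ]
      ring
    rw [this]
    simp
    ring
  · have f1 : (k + 1 + (j + 1)).factorial = (k + j + 2) * (k + j + 1) * (k + j).factorial := by
      rw [show k + 1 + (j + 1) = (k + j) + 1 + 1 by ring, Nat.factorial_succ,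
        Nat.factorial_succ]
      ring
    have f2 : (k + (j + 1)).factorial = (k + j + 1) * (k + j).factorial := by
      rw [← add_assoc, Nat.factorial_succ]
    have p1 : ∏ i ∈ Finset.Ico (j + 1 + 1) (k + 1 + 2), ((m : ℝ) - i) =
        (∏ i ∈ Finset.Ico (j + 1 + 1) (k + 2), ((m : ℝ) - i)) * (m - (k + 2)) := by
      rw [show k + 1 + 2 = (k + 2) + 1 by ring, Finset.prod_Ico_succ_top (by omega)]
      push_cast
      ring
    have p2 : ∏ i ∈ Finset.Ico (j + 1) (k + 2), ((m : ℝ) - i) =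
        (m - (j + 1)) * ∏ i ∈ Finset.Ico (j + 1 + 1) (k + 2), ((m : ℝ) - i) := by
      rw [Finset.prod_eq_prod_Ico_succ_bot (by omega)]
      push_cast
      ring
    have c1 : ((k + 1 + 1).choose (j + 1) : ℝ) = (k + 1).choose j + (k + 1).choose (j + 1) := by
      rw [Nat.choose_succ_succ]
      push_cast
      rfl
    have c2 : ((k + 1).choose (j + 1) : ℝ) * (j + 1) = (k + 1).choose j * (k + 1 - j) := by
      have := Nat.choose_succ_right_eq (k + 1) j
      have h2 : ((k + 1 - j : ℕ) : ℝ) = k + 1 - j := by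
        rw [Nat.cast_sub (by omega)]; push_cast; ring
      rw [← h2]
      exact_mod_cast this
    rw [f1, f2, p1, p2, c1]
    push_cast
    set P := ∏ i ∈ Finset.Ico (j + 1 + 1) (k + 2), ((m : ℝ) - i)
    linear_combination (2 ^ (2 * k + 3) * (k + j + 2) * (k + j + 1) * ((k + j).factorial : ℝ) * P) * c2

lemma logCoeff_eq_zero {m k j : ℕ} (h : j < m) (hk : m = k + 1) : logCoeff m k j = 0 := by
  have : ∏ i ∈ Finset.Ico (j + 1) (k + 2), ((m : ℝ) - i) = 0 :=
    Finset.prod_eq_zero (i := m) (by simp; omega) (by simp)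
  simp [logCoeff, this]

/-- A smooth regularization of `-log ‖y - x‖`. -/
def logKernel (t : ℝ) (x y : EuclideanSpace ℝ (Fin n)) : ℝ :=
  -(1 / 2) * Real.log (‖y - x‖ ^ 2 + t)

lemma contDiff_logKernel {t : ℝ} (ht : 0 < t) (x : EuclideanSpace ℝ (Fin n)) :
    ContDiff ℝ ∞ (logKernel t x) := by
  unfold logKernel
  refine contDiff_const.mul (ContDiff.log ?_ fun y => by positivity)
  exact ((contDiff_id.sub contDiff_const).norm_sq ℝ).add contDiff_const

lemma nlapIter_logKernel_eq_sum {m : ℕ} {t : ℝ} (ht : 0 < t)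
    (x : EuclideanSpace ℝ (Fin (2 * m))) (k : ℕ) :
    nlapIter (k + 1) (logKernel t x) = fun y => ∑ j ∈ Finset.range (k + 2),
      logCoeff m k j * t ^ j * ((‖y - x‖ ^ 2 + t)⁻¹) ^ (k + 1 + j) := by
  induction k with
  | zero =>
    ext y
    have h := nlap_comp_norm_sq (h := fun r => -(1 / 2) * Real.log r)
      (h' := fun r => -(1 / 2) * (r⁻¹) ^ 1) (h'' := fun r => (1 / 2) * (r⁻¹) ^ 2) ht
      (fun r hr => by simpa only [pow_one] using (Real.hasDerivAt_log hr.ne').const_mul (-(1 / 2)))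
      (fun r hr => by
        refine ((hasDerivAt_inv_pow 1 hr).const_mul (-(1 / 2))).congr_deriv ?_
        push_cast
        ring) x y
    have hs : 0 < ‖y - x‖ ^ 2 + t := by positivity
    have e : nlapIter (0 + 1) (logKernel t x) y =
      nlap (fun y => -(1 / 2) * Real.log (‖y - x‖ ^ 2 + t)) y := rfl
    rw [e, h]
    simp [logCoeff, Finset.sum_range_succ]
    field_simp
    ring
  | succ k ih =>
    rw [nlapIter_succ, ih]
    ext y
    have h := nlap_comp_norm_sq
      (h := fun r => ∑ j ∈ Finset.range (k + 2), logCoeff m k j * t ^ j * (r⁻¹) ^ (k + 1 + j))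
      (h' := fun r => ∑ j ∈ Finset.range (k + 2), logCoeff m k j * t ^ j *
        (-(k + 1 + j : ℕ) * (r⁻¹) ^ (k + 1 + j + 1)))
      (h'' := fun r => ∑ j ∈ Finset.range (k + 2), logCoeff m k j * t ^ j *
        (-(k + 1 + j : ℕ) * (-(k + 1 + j + 1 : ℕ) * (r⁻¹) ^ (k + 1 + j + 1 + 1)))) ht
      (fun r hr => HasDerivAt.fun_sum fun j _ => (hasDerivAt_inv_pow _ hr).const_mul _)
      (fun r hr => HasDerivAt.fun_sum fun j _ =>
        ((hasDerivAt_inv_pow _ hr).const_mul _).const_mul _) x y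
    rw [h]
    have hs : 0 < ‖y - x‖ ^ 2 + t := by positivity
    have hn : ‖y - x‖ ^ 2 = (‖y - x‖ ^ 2 + t) - t := by ring
    set s := ‖y - x‖ ^ 2 + t
    rw [hn]
    have hsq : s * s⁻¹ = 1 := mul_inv_cancel₀ hs.ne'
    set q := s⁻¹
    have e1 : -(2 * ((2 * m : ℕ) : ℝ) * ∑ j ∈ Finset.range (k + 2), logCoeff m k j * t ^ j *
          (-(k + 1 + j : ℕ) * q ^ (k + 1 + j + 1)) +
        4 * (s - t) * ∑ j ∈ Finset.range (k + 2), logCoeff m k j * t ^ j *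
          (-(k + 1 + j : ℕ) * (-(k + 1 + j + 1 : ℕ) * q ^ (k + 1 + j + 1 + 1)))) =
        (∑ j ∈ Finset.range (k + 2), 4 * (k + j + 1) * (m - (k + j + 2)) * logCoeff m k j *
          t ^ j * q ^ (k + 2 + j)) +
        ∑ j ∈ Finset.range (k + 2), 4 * (k + j + 1) * (k + j + 2) * logCoeff m k j *
          t ^ (j + 1) * q ^ (k + 2 + (j + 1)) := by
      rw [← Finset.sum_add_distrib, Finset.mul_sum, Finset.mul_sum, ← Finset.sum_add_distrib,
        ← Finset.sum_neg_distrib]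
      refine Finset.sum_congr rfl fun j _ => ?_
      push_cast
      have e2 : q ^ (k + 2 + j) = q ^ (k + 1 + j) * q := by ring
      have e3 : q ^ (k + 2 + (j + 1)) = q ^ (k + 1 + j) * q ^ 2 := by ring
      have e4 : q ^ (k + 1 + j + 1) = q ^ (k + 1 + j) * q := by ring
      have e5 : q ^ (k + 1 + j + 1 + 1) = q ^ (k + 1 + j) * q ^ 2 := by ring
      rw [e2, e3, e4, e5]
      set Q := q ^ (k + 1 + j)
      linear_combination (-4 * Q * q * logCoeff m k j * t ^ j * (k + 1 + j) * (k + 1 + j + 1)) * hsq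
    rw [e1, Finset.sum_range_succ' _ (k + 2)]
    have e6 : ∑ j ∈ Finset.range (k + 2), 4 * (k + j + 1) * (m - (k + j + 2)) * logCoeff m k j *
          t ^ j * q ^ (k + 2 + j) = ∑ j ∈ Finset.range (k + 2 + 1),
            4 * ((k : ℝ) + j + 1) * (m - (k + j + 2)) * logCoeff m k j * t ^ j * q ^ (k + 2 + j) := by
      rw [Finset.sum_range_succ _ (k + 2)]
      simp [logCoeff]
    rw [e6, Finset.sum_range_succ' _ (k + 2), add_right_comm, ← Finset.sum_add_distrib]
    congr 1
    · refine Finset.sum_congr rfl fun j hj => ?_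
      rw [logCoeff_succ_succ (by simp at hj; omega)]
      push_cast
      ring
    · rw [logCoeff_succ_zero]
      push_cast
      ring

lemma nlapIter_logKernel {m : ℕ} (hm : 1 ≤ m) {t : ℝ} (ht : 0 < t)
    (x y : EuclideanSpace ℝ (Fin (2 * m))) :
    nlapIter m (logKernel t x) y =
      2 ^ (2 * m - 1) * (2 * m - 1).factorial * (t ^ m * ((‖y - x‖ ^ 2 + t)⁻¹) ^ (2 * m)) := by
  obtain ⟨k, rfl⟩ : ∃ k, m = k + 1 := ⟨m - 1, by omega⟩
  simp only [nlapIter_logKernel_eq_sum ht]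
  rw [Finset.sum_range_succ, Finset.sum_eq_zero]
  · simp only [logCoeff]
    simp [show 2 * (k + 1) - 1 = k + (k + 1) by omega, show 2 * k + 1 = k + (k + 1) by omega,
      show k + 1 + (k + 1) = 2 * (k + 1) by omega]
    ring
  · intro j hj
    rw [logCoeff_eq_zero (by simpa using hj) rfl]
    simp

end LogKernel

section RemovableWeakForm

variable {n : ℕ}

lemma nlapIter_zero_fun (k : ℕ) : nlapIter k (fun _ : EuclideanSpace ℝ (Fin n) => (0 : ℝ)) = 0 := by
  have h := nlapIter_const_smul (f := fun _ : EuclideanSpace ℝ (Fin n) => (0 : ℝ)) k 0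
    contDiff_const
  simpa [Pi.zero_def] using! h

lemma integral_mul_nlapIter_of_vanishing {m : ℕ} {v ξ : EuclideanSpace ℝ (Fin n) → ℝ}
    (hv : ∀ y ≠ 0, ContDiffAt ℝ ((2 * m : ℕ)) v y) (hc : HasCompactSupport v)
    (hξ : ContDiff ℝ ((2 * m : ℕ)) ξ) {ε : ℝ} (hε : 0 < ε) (hξ0 : ∀ y ∈ ball 0 ε, ξ y = 0) :
    ∫ y, v y * nlapIter m ξ y = ∫ y, nlapIter m v y * ξ y := by
  let χ : ContDiffBump (0 : EuclideanSpace ℝ (Fin n)) :=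
    ⟨ε / 4, ε / 2, by positivity, by linarith⟩
  let w : EuclideanSpace ℝ (Fin n) → ℝ := fun y => (1 - χ y) * v y
  have hw : ContDiff ℝ ((2 * m : ℕ)) w := by
    refine contDiff_iff_contDiffAt.2 fun y => ?_
    by_cases hy : y = 0
    · have hχ1 : ⇑χ =ᶠ[𝓝 y] 1 := by rw [hy]; exact χ.eventuallyEq_one
      have h0 : w =ᶠ[𝓝 y] fun _ => 0 := by
        filter_upwards [hχ1] with z hz
        simp [w, hz]
      exact contDiffAt_const.congr_of_eventuallyEq h0
    · exact (contDiffAt_const.sub χ.contDiffAt).mul (hv y hy)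
  have hwc : HasCompactSupport w := hc.mul_left
  have heq (y) (hy : y ∉ ball (0 : EuclideanSpace ℝ (Fin n)) ε) : w =ᶠ[𝓝 y] v := by
    have : y ∈ (closedBall (0 : EuclideanSpace ℝ (Fin n)) (ε / 2))ᶜ := by
      simp at hy ⊢; linarith
    filter_upwards [isClosed_closedBall.isOpen_compl.mem_nhds this] with z hz
    have : χ z = 0 := χ.zero_of_le_dist (by simp at hz ⊢; exact hz.le)
    simp [w, this]
  have hξe (y) (hy : y ∈ ball (0 : EuclideanSpace ℝ (Fin n)) ε) : nlapIter m ξ y = 0 := by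
    have : ξ =ᶠ[𝓝 y] fun _ => 0 := by
      filter_upwards [isOpen_ball.mem_nhds hy] with z hz using hξ0 z hz
    rw [(nlapIter_eventuallyEq m this).eq_of_nhds, nlapIter_zero_fun]
    rfl
  have h := integral_mul_nlapIter m hw hξ hwc
  calc _ = ∫ y, w y * nlapIter m ξ y := by
        refine integral_congr_ae (Eventually.of_forall fun y => ?_)
        by_cases hy : y ∈ ball (0 : EuclideanSpace ℝ (Fin n)) ε
        · simp [hξe y hy]
        · simp only [(heq y hy).eq_of_nhds]
    _ = _ := h
    _ = _ := by
        refine integral_congr_ae (Eventually.of_forall fun y => ?_)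
        by_cases hy : y ∈ ball (0 : EuclideanSpace ℝ (Fin n)) ε
        · simp [hξ0 y hy]
        · simp only [(nlapIter_eventuallyEq m (heq y hy)).eq_of_nhds]

lemma exists_bound_iteratedFDeriv_of_hasCompactSupport {f : EuclideanSpace ℝ (Fin n) → ℝ}
    (hf : ContDiff ℝ ∞ f) (hc : HasCompactSupport f) (N : ℕ) :
    ∃ A : ℝ, 0 ≤ A ∧ ∀ i ≤ N, ∀ y, ‖iteratedFDeriv ℝ i f y‖ ≤ A := by
  have h (i : ℕ) : ∃ A : ℝ, ∀ y, ‖iteratedFDeriv ℝ i f y‖ ≤ A :=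
    (hc.iteratedFDeriv i).exists_bound_of_continuous
      (hf.continuous_iteratedFDeriv (WithTop.coe_le_coe.2 le_top))
  choose A hA using h
  have hA0 (i : ℕ) : 0 ≤ A i := (norm_nonneg _).trans (hA i 0)
  refine ⟨∑ i ∈ Finset.range (N + 1), A i, Finset.sum_nonneg fun i _ => hA0 i, fun i hi y => ?_⟩
  exact (hA i y).trans (Finset.single_le_sum (f := A) (fun i _ => hA0 i) (by simp; omega))

lemma exists_bound_iteratedFDeriv_closedBall {f : EuclideanSpace ℝ (Fin n) → ℝ}
    (hf : ContDiff ℝ ∞ f) (N : ℕ) :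
    ∃ A : ℝ, 0 ≤ A ∧ ∀ i ≤ N, ∀ y ∈ closedBall (0 : EuclideanSpace ℝ (Fin n)) 1,
      ‖iteratedFDeriv ℝ i f y‖ ≤ A := by
  have h (i : ℕ) : ∃ A : ℝ, ∀ y ∈ closedBall (0 : EuclideanSpace ℝ (Fin n)) 1,
      ‖iteratedFDeriv ℝ i f y‖ ≤ A :=
    (isCompact_closedBall 0 1).exists_bound_of_continuousOn
      (hf.continuous_iteratedFDeriv (WithTop.coe_le_coe.2 le_top)).continuousOn
  choose A hA using h
  have hA0 (i : ℕ) : 0 ≤ A i := (norm_nonneg _).trans (hA i 0 (by simp))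
  refine ⟨∑ i ∈ Finset.range (N + 1), A i, Finset.sum_nonneg fun i _ => hA0 i, fun i hi y hy => ?_⟩
  exact (hA i y hy).trans (Finset.single_le_sum (f := A) (fun i _ => hA0 i) (by simp; omega))

lemma norm_le_of_jet_eq_zero {ζ : EuclideanSpace ℝ (Fin n) → ℝ} (hζ : ContDiff ℝ ∞ ζ)
    (h0 : ζ 0 = 0) (h1 : fderiv ℝ ζ 0 = 0) {B : ℝ}
    (hB : ∀ y ∈ closedBall (0 : EuclideanSpace ℝ (Fin n)) 1, ‖iteratedFDeriv ℝ 2 ζ y‖ ≤ B)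
    {y : EuclideanSpace ℝ (Fin n)} (hy : ‖y‖ ≤ 1) :
    ‖fderiv ℝ ζ y‖ ≤ B * ‖y‖ ∧ |ζ y| ≤ B * ‖y‖ ^ 2 := by
  have hB0 : 0 ≤ B := (norm_nonneg _).trans (hB 0 (by simp))
  have hζ' : ContDiff ℝ ∞ (fderiv ℝ ζ) := hζ.fderiv_right (by simp)
  have first {y : EuclideanSpace ℝ (Fin n)} (hy : ‖y‖ ≤ 1) : ‖fderiv ℝ ζ y‖ ≤ B * ‖y‖ := by
    have := (convex_closedBall (0 : EuclideanSpace ℝ (Fin n)) 1).norm_image_sub_le_of_norm_fderiv_le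
      (𝕜 := ℝ) (f := fderiv ℝ ζ) (C := B) (x := 0) (y := y)
      (fun z _ => hζ'.differentiable (by simp) z) (fun z hz => by
        rw [← norm_iteratedFDeriv_one, norm_iteratedFDeriv_fderiv]; exact hB z hz) (by simp)
      (by simpa using hy)
    simpa [h1] using this
  refine ⟨first hy, ?_⟩
  have := (convex_closedBall (0 : EuclideanSpace ℝ (Fin n)) ‖y‖).norm_image_sub_le_of_norm_fderiv_le
      (𝕜 := ℝ) (f := ζ) (C := B * ‖y‖) (x := 0) (y := y)
      (fun z _ => hζ.differentiable (by simp) z) (fun z hz => by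
        have hz' : ‖z‖ ≤ ‖y‖ := by simpa using hz
        exact (first (hz'.trans hy)).trans (by gcongr)) (by simp) (by simp)
  rw [h0, sub_zero, sub_zero, Real.norm_eq_abs] at this
  linarith [this, show B * ‖y‖ * ‖y‖ = B * ‖y‖ ^ 2 by ring]

lemma exists_bound_nlapIter_cutoff_mul {m : ℕ} (hm : 1 ≤ m)
    {χ ζ : EuclideanSpace ℝ (Fin n) → ℝ} (hχ : ContDiff ℝ ∞ χ) (hχc : HasCompactSupport χ)
    (hζ : ContDiff ℝ ∞ ζ) (h0 : ζ 0 = 0) (h1 : fderiv ℝ ζ 0 = 0) :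
    ∃ C : ℝ, 0 ≤ C ∧ ∀ ε : ℝ, 0 < ε → ε ≤ 1 → ∀ y, ‖y‖ ≤ ε →
      |nlapIter m (fun y => χ (ε⁻¹ • y) * ζ y) y| ≤ C * (ε⁻¹) ^ (2 * m - 2) := by
  obtain ⟨A, hA0, hA⟩ := exists_bound_iteratedFDeriv_of_hasCompactSupport hχ hχc (2 * m)
  obtain ⟨B, hB0, hB⟩ := exists_bound_iteratedFDeriv_closedBall hζ (2 * m)
  refine ⟨n ^ m * ∑ i ∈ Finset.range (2 * m + 1), (2 * m).choose i * A * B, by positivity,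
    fun ε hε hε1 y hy => ?_⟩
  have hχε : ContDiff ℝ ∞ (fun y => χ (ε⁻¹ • y)) := hχ.comp (contDiff_const_smul ε⁻¹)
  have hi1 : 1 ≤ ε⁻¹ := (one_le_inv₀ hε).2 hε1
  have hy1 : ‖y‖ ≤ 1 := hy.trans hε1
  have top (k : ℕ) : ((k : ℕ) : WithTop ℕ∞) ≤ ((⊤ : ℕ∞) : WithTop ℕ∞) := WithTop.coe_le_coe.2 le_top
  obtain ⟨j1, j0⟩ := norm_le_of_jet_eq_zero hζ h0 h1 (hB 2 (by omega)) hy1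
  have hζb (i : ℕ) (hi : i ≤ 2 * m) :
      (ε⁻¹) ^ i * ‖iteratedFDeriv ℝ (2 * m - i) ζ y‖ ≤ B * (ε⁻¹) ^ (2 * m - 2) := by
    rcases (by omega : i = 2 * m ∨ i = 2 * m - 1 ∨ i ≤ 2 * m - 2) with h | h | h
    · have e : (ε⁻¹) ^ i = (ε⁻¹) ^ (2 * m - 2) * (ε⁻¹) ^ 2 := by
        rw [← pow_add]; congr 1; omega
      have : ‖iteratedFDeriv ℝ (2 * m - i) ζ y‖ ≤ B * ε ^ 2 := by
        rw [h, Nat.sub_self, norm_iteratedFDeriv_zero]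
        exact j0.trans (by gcongr)
      calc _ ≤ (ε⁻¹) ^ i * (B * ε ^ 2) := by gcongr
        _ = _ := by rw [e]; field_simp
    · have e : (ε⁻¹) ^ i = (ε⁻¹) ^ (2 * m - 2) * ε⁻¹ := by
        rw [← pow_succ]; congr 1; omega
      have : ‖iteratedFDeriv ℝ (2 * m - i) ζ y‖ ≤ B * ε := by
        rw [h, show 2 * m - (2 * m - 1) = 1 by omega, norm_iteratedFDeriv_one]
        exact j1.trans (by gcongr)
      calc _ ≤ (ε⁻¹) ^ i * (B * ε) := by gcongr
        _ = _ := by rw [e]; field_simp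
    · rw [mul_comm]
      have := hB (2 * m - i) (by omega) y (by simpa using hy1)
      gcongr
  refine (abs_nlapIter_le m ((hχε.mul hζ).of_le (top _))).trans ?_
  rw [mul_assoc]
  gcongr
  refine (norm_iteratedFDeriv_mul_le hχε hζ y (top _)).trans ?_
  rw [Finset.sum_mul]
  refine Finset.sum_le_sum fun i hi => ?_
  have hi' : i ≤ 2 * m := by simp at hi; omega
  rw [iteratedFDeriv_comp_const_smul _ (hχ.of_le (top _)), norm_smul, norm_pow,
    Real.norm_of_nonneg (by positivity : 0 ≤ ε⁻¹)]
  have e := hζb i hi'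
  have eA := hA i hi' (ε⁻¹ • y)
  calc _ = ((2 * m).choose i) * ‖iteratedFDeriv ℝ i χ (ε⁻¹ • y)‖ *
        (ε⁻¹ ^ i * ‖iteratedFDeriv ℝ (2 * m - i) ζ y‖) := by ring
    _ ≤ ((2 * m).choose i) * A * (B * (ε⁻¹) ^ (2 * m - 2)) := by gcongr
    _ = _ := by ring

/-- Green's identity across an isolated singularity, for test functions with vanishing `1`-jet. -/
lemma integral_mul_nlapIter_of_jet_eq_zero {m : ℕ} (hm : 1 ≤ m)
    {v ζ : EuclideanSpace ℝ (Fin n) → ℝ}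
    (hv : ∀ y ≠ 0, ContDiffAt ℝ ((2 * m : ℕ)) v y) (hc : HasCompactSupport v)
    (hvi : Integrable v) (hgi : Integrable (nlapIter m v))
    (ho : ∀ ε > (0 : ℝ), ∃ δ > (0 : ℝ), ∀ r : ℝ, 0 < r → r < δ →
      ∫ y in ball 0 r, |v y| ≤ ε * r ^ (2 * m - 2))
    (hζ : ContDiff ℝ ∞ ζ) (h0 : ζ 0 = 0) (h1 : fderiv ℝ ζ 0 = 0) :
    ∫ y, v y * nlapIter m ζ y = ∫ y, nlapIter m v y * ζ y := by
  let χ : ContDiffBump (0 : EuclideanSpace ℝ (Fin n)) :=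
    ⟨1 / 4, 1 / 2, by positivity, by norm_num⟩
  have hχ : ContDiff ℝ ∞ χ := χ.contDiff
  obtain ⟨C, hC0, hC⟩ := exists_bound_nlapIter_cutoff_mul hm hχ χ.hasCompactSupport hζ h0 h1
  obtain ⟨B, hB0, hB⟩ := exists_bound_iteratedFDeriv_closedBall hζ 2
  have top (k : ℕ) : ((k : ℕ) : WithTop ℕ∞) ≤ ((⊤ : ℕ∞) : WithTop ℕ∞) := WithTop.coe_le_coe.2 le_top
  have hmulc {f : EuclideanSpace ℝ (Fin n) → ℝ} (hf : Continuous f) :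
      Integrable (fun y => v y * f y) := by
    obtain ⟨M, hM⟩ := hc.exists_bound_of_continuousOn (f := f) hf.continuousOn
    refine (hvi.norm.mul_const M).mono' (hvi.aestronglyMeasurable.mul hf.aestronglyMeasurable)
      (Eventually.of_forall fun y => ?_)
    by_cases hy : y ∈ tsupport v
    · rw [norm_mul]
      exact mul_le_mul_of_nonneg_left (hM y hy) (norm_nonneg _)
    · simp [image_eq_zero_of_notMem_tsupport hy]
  have hgc : HasCompactSupport (nlapIter m v) :=
    hc.of_isClosed_subset (isClosed_tsupport _) (tsupport_nlapIter_subset m)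
  have hmulg {f : EuclideanSpace ℝ (Fin n) → ℝ} (hf : Continuous f) :
      Integrable (fun y => nlapIter m v y * f y) := by
    obtain ⟨M, hM⟩ := hgc.exists_bound_of_continuousOn (f := f) hf.continuousOn
    refine (hgi.norm.mul_const M).mono' (hgi.aestronglyMeasurable.mul hf.aestronglyMeasurable)
      (Eventually.of_forall fun y => ?_)
    by_cases hy : y ∈ tsupport (nlapIter m v)
    · rw [norm_mul]
      exact mul_le_mul_of_nonneg_left (hM y hy) (norm_nonneg _)
    · simp [image_eq_zero_of_notMem_tsupport hy]
  have main (η : ℝ) (hη : 0 < η) : ∃ δ > 0, ∀ ε : ℝ, 0 < ε → ε < δ →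
      |(∫ y, v y * nlapIter m ζ y) - ∫ y, nlapIter m v y * ζ y| ≤
        C * η + B * ε ^ 2 * ∫ y, |nlapIter m v y| := by
    obtain ⟨δ, hδ, hδ'⟩ := ho η hη
    refine ⟨min δ 1, by positivity, fun ε hε hεδ => ?_⟩
    have hε1 : ε ≤ 1 := (hεδ.trans_le (min_le_right _ _)).le
    have hχε : ContDiff ℝ ∞ (fun y => χ (ε⁻¹ • y)) := hχ.comp (contDiff_const_smul ε⁻¹)
    set ξ : EuclideanSpace ℝ (Fin n) → ℝ := fun y => χ (ε⁻¹ • y) * ζ y with hξdef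
    have hξ : ContDiff ℝ ∞ ξ := hχε.mul hζ
    have hdist (y : EuclideanSpace ℝ (Fin n)) : dist (ε⁻¹ • y) 0 = ε⁻¹ * ‖y‖ := by
      rw [dist_zero_right, norm_smul, Real.norm_of_nonneg (by positivity)]
    have hgreen := integral_mul_nlapIter_of_vanishing hv hc (ξ := ζ - ξ)
      ((hζ.sub hξ).of_le (top _)) (ε := ε / 4) (by positivity) (fun y hy => by
        have : χ (ε⁻¹ • y) = 1 := χ.one_of_mem_closedBall (by
          rw [mem_closedBall, hdist]
          have : ‖y‖ < ε / 4 := by simpa using hy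
          change ε⁻¹ * ‖y‖ ≤ 1 / 4
          rw [inv_mul_le_iff₀ hε]
          linarith)
        simp [hξdef, this])
    have hξ0 (y) (hy : y ∉ ball (0 : EuclideanSpace ℝ (Fin n)) ε) : ξ =ᶠ[𝓝 y] fun _ => 0 := by
      have : y ∈ (closedBall (0 : EuclideanSpace ℝ (Fin n)) (ε / 2))ᶜ := by
        simp at hy ⊢; linarith
      filter_upwards [isClosed_closedBall.isOpen_compl.mem_nhds this] with z hz
      have : χ (ε⁻¹ • z) = 0 := χ.zero_of_le_dist (by
        rw [hdist]
        change 1 / 2 ≤ ε⁻¹ * ‖z‖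
        rw [le_inv_mul_iff₀ hε]
        simp at hz
        linarith)
      simp [hξdef, this]
    have hsub : (∫ y, v y * nlapIter m ζ y) - ∫ y, nlapIter m v y * ζ y =
        (∫ y, v y * nlapIter m ξ y) - ∫ y, nlapIter m v y * ξ y := by
      rw [nlapIter_sub m hζ hξ] at hgreen
      simp only [Pi.sub_apply, mul_sub] at hgreen
      rw [integral_sub (hmulc (contDiff_infty_nlapIter m hζ).continuous)
        (hmulc (contDiff_infty_nlapIter m hξ).continuous),
        integral_sub (hmulg hζ.continuous) (hmulg hξ.continuous)] at hgreen
      linarith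
    rw [hsub]
    refine (abs_sub _ _).trans (add_le_add ?_ ?_)
    · have hz (y) (hy : y ∉ ball (0 : EuclideanSpace ℝ (Fin n)) ε) : nlapIter m ξ y = 0 := by
        rw [(nlapIter_eventuallyEq m (hξ0 y hy)).eq_of_nhds, nlapIter_zero_fun]
        rfl
      rw [← setIntegral_eq_integral_of_forall_compl_eq_zero (s := ball 0 ε)
        (fun y hy => by rw [hz y hy, mul_zero])]
      calc |∫ y in ball 0 ε, v y * nlapIter m ξ y|
          ≤ ∫ y in ball 0 ε, |v y| * (C * (ε⁻¹) ^ (2 * m - 2)) := by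
            refine (abs_integral_le_integral_abs).trans ?_
            refine setIntegral_mono_on (hmulc (contDiff_infty_nlapIter m hξ).continuous).abs.integrableOn
              (hvi.abs.mul_const _).integrableOn measurableSet_ball fun y hy => ?_
            rw [abs_mul]
            gcongr
            exact hC ε hε hε1 y (by simpa using (mem_ball.1 hy).le)
        _ = (∫ y in ball 0 ε, |v y|) * (C * (ε⁻¹) ^ (2 * m - 2)) := by rw [integral_mul_const]
        _ ≤ (η * ε ^ (2 * m - 2)) * (C * (ε⁻¹) ^ (2 * m - 2)) := by
            gcongr
            exact hδ' ε hε (hεδ.trans_le (min_le_left _ _))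
        _ = C * η * (ε * ε⁻¹) ^ (2 * m - 2) := by rw [mul_pow]; ring
        _ = C * η := by rw [mul_inv_cancel₀ hε.ne', one_pow, mul_one]
    · rw [← integral_const_mul]
      refine (abs_integral_le_integral_abs).trans ?_
      refine integral_mono (hmulg hξ.continuous).abs (hgi.abs.const_mul _) fun y => ?_
      simp only [abs_mul]
      rw [mul_comm]
      gcongr
      by_cases hy : y ∈ ball (0 : EuclideanSpace ℝ (Fin n)) ε
      · have hyε : ‖y‖ ≤ ε := by simpa using (mem_ball.1 hy).le
        have j0 := (norm_le_of_jet_eq_zero hζ h0 h1 (hB 2 le_rfl) (hyε.trans hε1)).2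
        rw [hξdef, abs_mul, abs_of_nonneg χ.nonneg]
        calc _ ≤ 1 * (B * ‖y‖ ^ 2) := by gcongr; exact χ.le_one
          _ ≤ B * ε ^ 2 := by rw [one_mul]; gcongr
      · rw [(hξ0 y hy).eq_of_nhds, abs_zero]
        positivity
  have hG : 0 ≤ ∫ y, |nlapIter m v y| := integral_nonneg fun y => abs_nonneg _
  refine sub_eq_zero.1 (abs_eq_zero.1 (le_antisymm (le_of_forall_pos_le_add fun κ hκ => ?_)
    (abs_nonneg _)))
  obtain ⟨δ, hδ, hmain⟩ := main (κ / (2 * (C + 1))) (by positivity)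
  have hlim : Tendsto (fun ε : ℝ => C * (κ / (2 * (C + 1))) + B * ε ^ 2 * ∫ y, |nlapIter m v y|)
      (𝓝[>] 0) (𝓝 (C * (κ / (2 * (C + 1))) + B * 0 ^ 2 * ∫ y, |nlapIter m v y|)) :=
    (Continuous.tendsto (by fun_prop) 0).mono_left nhdsWithin_le_nhds
  have hle : |(∫ y, v y * nlapIter m ζ y) - ∫ y, nlapIter m v y * ζ y| ≤
      C * (κ / (2 * (C + 1))) + B * 0 ^ 2 * ∫ y, |nlapIter m v y| := by
    refine ge_of_tendsto hlim ?_
    filter_upwards [Ioo_mem_nhdsGT hδ] with ε hε using hmain ε hε.1 hε.2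
  refine hle.trans ?_
  have : C * (κ / (2 * (C + 1))) ≤ κ := by
    rw [mul_div_assoc', div_le_iff₀ (by positivity)]
    nlinarith
  simpa using this

end RemovableWeakForm

section Representation

variable {n : ℕ}

lemma integrableOn_norm_sub_rpow {a : ℝ} (ha : a < n) (x : EuclideanSpace ℝ (Fin n)) (R : ℝ) :
    IntegrableOn (fun y => ‖y - x‖ ^ (-a)) (ball x R) := by
  rcases Nat.eq_zero_or_pos n with rfl | hn
  · exact (integrableOn_const (C := (‖x - x‖ ^ (-a) : ℝ)) measure_ball_lt_top.ne).congr_fun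
      (fun y _ => by rw [Subsingleton.elim y x]) measurableSet_ball
  have : Nonempty (Fin n) := ⟨⟨0, hn⟩⟩
  have h0 : IntegrableOn (fun y : EuclideanSpace ℝ (Fin n) => ‖y‖ ^ (-a)) (ball 0 R) := by
    refine (integrableOn_fun_norm_addHaar (μ := volume) (f := fun r : ℝ => r ^ (-a))).2 ?_
    rw [finrank_euclideanSpace_fin]
    have h1 : IntegrableOn (fun r : ℝ => r ^ ((n : ℝ) - 1 - a)) (Ioo 0 R) := by
      rcases le_or_gt R 0 with hR | hR
      · simp [Ioo_eq_empty_of_le hR]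
      · exact (intervalIntegral.intervalIntegrable_rpow' (a := 0) (b := R) (by linarith)).1.mono_set
          Ioo_subset_Ioc_self
    refine h1.congr_fun (fun r hr => ?_) measurableSet_Ioo
    simp only [smul_eq_mul]
    rw [← Real.rpow_natCast, ← Real.rpow_add hr.1, Nat.cast_sub hn]
    congr 1
    push_cast
    ring
  have hmp := measurePreserving_sub_right (volume : Measure (EuclideanSpace ℝ (Fin n))) x
  have h2 := (hmp.integrableOn_comp_preimage (MeasurableEquiv.subRight x).measurableEmbedding
    (f := fun y : EuclideanSpace ℝ (Fin n) => ‖y‖ ^ (-a)) (s := ball 0 R)).2 h0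
  have e : (fun y => y - x) ⁻¹' (ball (0 : EuclideanSpace ℝ (Fin n)) R) = ball x R := by
    ext y
    simp [dist_eq_norm]
  rw [e] at h2
  exact h2

lemma abs_log_le_add_inv {r : ℝ} (hr : 0 ≤ r) : |Real.log r| ≤ r + r⁻¹ := by
  rcases hr.eq_or_lt with rfl | hr
  · simp
  have h1 := Real.log_le_self hr.le
  have h2 := Real.log_le_self (inv_pos.2 hr).le
  rw [Real.log_inv] at h2
  have := inv_pos.2 hr
  rw [abs_le]
  constructor <;> linarith

lemma integrable_mul_of_tsupport_bdd {g f : EuclideanSpace ℝ (Fin n) → ℝ} (hg : Integrable g)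
    (hc : HasCompactSupport g) (hf : Continuous f) : Integrable (fun y => g y * f y) := by
  obtain ⟨M, hM⟩ := hc.exists_bound_of_continuousOn (f := f) hf.continuousOn
  refine (hg.norm.mul_const M).mono' (hg.aestronglyMeasurable.mul hf.aestronglyMeasurable)
    (Eventually.of_forall fun y => ?_)
  by_cases hy : y ∈ tsupport g
  · rw [norm_mul]
    exact mul_le_mul_of_nonneg_left (hM y hy) (norm_nonneg _)
  · simp [image_eq_zero_of_notMem_tsupport hy]

lemma integrable_mul_norm_sub_rpow {g : EuclideanSpace ℝ (Fin n) → ℝ} (hg : Integrable g)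
    {x : EuclideanSpace ℝ (Fin n)} (hx : ContinuousAt g x) {a : ℝ} (ha0 : 0 ≤ a) (ha : a < n) :
    Integrable (fun y => g y * ‖y - x‖ ^ (-a)) := by
  obtain ⟨δ, hδ, hM⟩ : ∃ δ > 0, ∀ y ∈ ball x δ, |g y| ≤ |g x| + 1 := by
    have := hx.abs.eventually (gt_mem_nhds (lt_add_one |g x|))
    obtain ⟨δ, hδ, h⟩ := Metric.eventually_nhds_iff_ball.1 this
    exact ⟨δ, hδ, fun y hy => (h y hy).le⟩
  have hloc := (integrable_indicator_iff (measurableSet_ball (x := x) (ε := δ))).2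
    (integrableOn_norm_sub_rpow ha x δ)
  refine ((hloc.const_mul (|g x| + 1)).add (hg.norm.mul_const (δ ^ (-a)))).mono'
    (hg.aestronglyMeasurable.mul ((by fun_prop : Measurable fun y : EuclideanSpace ℝ (Fin n) =>
      ‖y - x‖).pow_const (-a)).aestronglyMeasurable) (Eventually.of_forall fun y => ?_)
  have h0 : 0 ≤ ‖y - x‖ ^ (-a) := by positivity
  have h1 : 0 ≤ δ ^ (-a) := by positivity
  simp only [Pi.add_apply]
  rw [norm_mul, Real.norm_of_nonneg h0]
  by_cases hy : y ∈ ball x δ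
  · rw [indicator_of_mem hy]
    have := hM y hy
    rw [← Real.norm_eq_abs] at this
    have e : 0 ≤ ‖g y‖ * δ ^ (-a) := by positivity
    nlinarith
  · rw [indicator_of_notMem hy, mul_zero, zero_add]
    have hy' : δ ≤ ‖y - x‖ := by simpa [dist_eq_norm] using hy
    gcongr ?_ * ?_
    exact Real.rpow_le_rpow_of_nonpos hδ hy' (by linarith)

lemma integrable_mul_log_norm_sub (hn : 2 ≤ n) {g : EuclideanSpace ℝ (Fin n) → ℝ}
    (hg : Integrable g) (hc : HasCompactSupport g) {x : EuclideanSpace ℝ (Fin n)}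
    (hx : ContinuousAt g x) : Integrable (fun y => g y * Real.log ‖y - x‖) := by
  have h1 := integrable_mul_norm_sub_rpow hg hx zero_le_one
    (by exact_mod_cast hn : (1 : ℝ) < n)
  have h2 := integrable_mul_of_tsupport_bdd hg hc (f := fun y => ‖y - x‖) (by fun_prop)
  refine (h1.norm.add h2.norm).mono' (hg.aestronglyMeasurable.mul
    (Real.measurable_log.comp (by fun_prop)).aestronglyMeasurable)
    (Eventually.of_forall fun y => ?_)
  simp only [Pi.add_apply]
  rw [norm_mul, norm_mul, norm_mul, ← mul_add, norm_norm, Real.norm_of_nonneg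
    (by positivity : 0 ≤ ‖y - x‖ ^ (-1 : ℝ)), Real.rpow_neg_one, Real.norm_eq_abs (Real.log _)]
  gcongr
  rw [add_comm]
  exact abs_log_le_add_inv (norm_nonneg _)

lemma abs_logKernel_le {t : ℝ} (ht : 0 < t) (ht1 : t ≤ 1) {x y : EuclideanSpace ℝ (Fin n)}
    (hxy : y ≠ x) : |logKernel t x y| ≤ |Real.log ‖y - x‖| + ‖y - x‖ ^ 2 := by
  have hr : 0 < ‖y - x‖ := norm_pos_iff.2 (sub_ne_zero.2 hxy)
  have h1 : Real.log (‖y - x‖ ^ 2 + t) ≤ ‖y - x‖ ^ 2 := by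
    have := Real.log_le_sub_one_of_pos (by positivity : 0 < ‖y - x‖ ^ 2 + t)
    linarith
  have h2 : 2 * Real.log ‖y - x‖ ≤ Real.log (‖y - x‖ ^ 2 + t) := by
    have := Real.log_le_log (by positivity : 0 < ‖y - x‖ ^ 2) (le_add_of_nonneg_right ht.le)
    rw [Real.log_pow] at this
    exact_mod_cast this
  have h3 := neg_abs_le (Real.log ‖y - x‖)
  have h4 := abs_nonneg (Real.log ‖y - x‖)
  rw [logKernel, abs_le]
  constructor <;> nlinarith [sq_nonneg ‖y - x‖]

lemma tendsto_integral_mul_logKernel (hn : 2 ≤ n) {g : EuclideanSpace ℝ (Fin n) → ℝ}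
    (hg : Integrable g) (hc : HasCompactSupport g) {x : EuclideanSpace ℝ (Fin n)}
    (hx : ContinuousAt g x) :
    Tendsto (fun c : ℝ => ∫ y, g y * logKernel ((c⁻¹) ^ 2) x y) atTop
      (𝓝 (∫ y, g y * -Real.log ‖y - x‖)) := by
  have : Nontrivial (EuclideanSpace ℝ (Fin n)) := by
    have : Nonempty (Fin n) := ⟨⟨0, by omega⟩⟩
    infer_instance
  have hae : ∀ᵐ y : EuclideanSpace ℝ (Fin n), y ≠ x :=
    (measure_eq_zero_iff_ae_notMem.1 (measure_singleton x)).mono fun y hy => by simpa using hy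
  refine tendsto_integral_filter_of_dominated_convergence
    (fun y => ‖g y * Real.log ‖y - x‖‖ + ‖g y * ‖y - x‖ ^ 2‖) ?_ ?_ ?_ ?_
  · filter_upwards [eventually_gt_atTop 0] with c hc
    exact hg.aestronglyMeasurable.mul
      (contDiff_logKernel (by positivity) x).continuous.aestronglyMeasurable
  · filter_upwards [eventually_ge_atTop 1] with c hc
    filter_upwards [hae] with y hy
    have hc0 : 0 < c := by linarith
    rw [norm_mul, norm_mul, norm_mul, ← mul_add, Real.norm_eq_abs (logKernel _ _ _),
      Real.norm_eq_abs (Real.log _), Real.norm_of_nonneg (sq_nonneg ‖y - x‖)]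
    gcongr
    exact abs_logKernel_le (by positivity)
      (pow_le_one₀ (by positivity) (inv_le_one_of_one_le₀ hc)) hy
  · exact (integrable_mul_log_norm_sub hn hg hc hx).norm.add
      (integrable_mul_of_tsupport_bdd hg hc (by fun_prop)).norm
  · filter_upwards [hae] with y hy
    have hr : 0 < ‖y - x‖ := norm_pos_iff.2 (sub_ne_zero.2 hy)
    refine Tendsto.const_mul _ ?_
    have h1 : Tendsto (fun c : ℝ => ‖y - x‖ ^ 2 + (c⁻¹) ^ 2) atTop (𝓝 (‖y - x‖ ^ 2 + 0 ^ 2)) :=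
      tendsto_const_nhds.add (tendsto_inv_atTop_zero.pow 2)
    have h2 := (h1.log (by positivity)).const_mul (-(1 / 2))
    have e : -Real.log ‖y - x‖ = -(1 / 2) * Real.log (‖y - x‖ ^ 2 + 0 ^ 2) := by
      rw [zero_pow two_ne_zero, add_zero, Real.log_pow]
      push_cast
      ring
    rw [e]
    exact h2

lemma fderiv_logKernel_zero {t : ℝ} (ht : 0 < t) (x y : EuclideanSpace ℝ (Fin n)) :
    fderiv ℝ (logKernel t x) 0 y = inner ℝ x y / (‖x‖ ^ 2 + t) := by
  have h1 : HasFDerivAt (fun y : EuclideanSpace ℝ (Fin n) => ‖y - x‖ ^ 2 + t)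
      (2 • (innerSL ℝ (0 - x))) 0 := by
    simpa using! (((hasFDerivAt_id (0 : EuclideanSpace ℝ (Fin n))).sub_const x).norm_sq).add_const t
  have h2 := (h1.log (by positivity)).const_mul (-(1 / 2))
  have h3 : fderiv ℝ (logKernel t x) 0 = _ := h2.fderiv
  rw [h3]
  simp
  ring

/-- The profile of the standard bubble in dimension `2 * m`. -/
def bubble (m : ℕ) (z : EuclideanSpace ℝ (Fin (2 * m))) : ℝ := ((1 + ‖z‖ ^ 2)⁻¹) ^ (2 * m)

lemma bubble_pos (m : ℕ) (z : EuclideanSpace ℝ (Fin (2 * m))) : 0 < bubble m z := by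
  unfold bubble
  positivity

lemma integrable_bubble {m : ℕ} (hm : 1 ≤ m) : Integrable (bubble m) := by
  have h := integrable_rpow_neg_one_add_norm_sq (E := EuclideanSpace ℝ (Fin (2 * m)))
    (μ := volume) (r := 4 * m) (by
      rw [finrank_euclideanSpace_fin]
      have : (1 : ℝ) ≤ m := by exact_mod_cast hm
      push_cast
      linarith)
  refine h.congr (Eventually.of_forall fun z => ?_)
  have h0 : (0 : ℝ) ≤ 1 + ‖z‖ ^ 2 := by positivity
  simp only [bubble]
  rw [show -(4 * (m : ℝ)) / 2 = -((2 * m : ℕ) : ℝ) by push_cast; ring, Real.rpow_neg h0,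
    Real.rpow_natCast, inv_pow]

lemma integral_bubble_pos {m : ℕ} (hm : 1 ≤ m) : 0 < ∫ z, bubble m z := by
  refine (integral_pos_iff_support_of_nonneg (fun z => (bubble_pos m z).le)
    (integrable_bubble hm)).2 ?_
  have : Function.support (bubble m) = univ := by
    ext z
    simp [(bubble_pos m z).ne']
  rw [this]
  exact Measure.measure_univ_pos.2 (NeZero.ne _)

/-- The normalizing constant of the fundamental solution `-log ‖x‖` of `(-Δ)^m`. -/
def logConst (m : ℕ) : ℝ := 2 ^ (2 * m - 1) * (2 * m - 1).factorial * ∫ z, bubble m z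

lemma logConst_pos {m : ℕ} (hm : 1 ≤ m) : 0 < logConst m := by
  have := integral_bubble_pos hm
  unfold logConst
  positivity

lemma tendsto_norm_pow_mul_bubble {m : ℕ} (hm : 1 ≤ m) (a : ℝ) (ha : 0 ≤ a) :
    Tendsto (fun z : EuclideanSpace ℝ (Fin (2 * m)) =>
      ‖z‖ ^ Module.finrank ℝ (EuclideanSpace ℝ (Fin (2 * m))) * (a * bubble m z))
      (Bornology.cobounded (EuclideanSpace ℝ (Fin (2 * m)))) (𝓝 0) := by
  have h1 : Tendsto (fun z : EuclideanSpace ℝ (Fin (2 * m)) => a * (‖z‖⁻¹) ^ (2 * m))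
      (Bornology.cobounded (EuclideanSpace ℝ (Fin (2 * m)))) (𝓝 (a * 0 ^ (2 * m))) :=
    Tendsto.const_mul _ (Tendsto.pow (tendsto_inv_atTop_zero.comp tendsto_norm_cobounded_atTop) _)
  rw [zero_pow (by omega), mul_zero] at h1
  refine squeeze_zero (fun z => mul_nonneg (by positivity) (mul_nonneg ha (bubble_pos m z).le))
    (fun z => ?_) h1
  rw [finrank_euclideanSpace_fin, bubble, mul_left_comm, ← mul_pow]
  refine mul_le_mul_of_nonneg_left (pow_le_pow_left₀ (by positivity) ?_ _) ha
  rcases (norm_nonneg z).eq_or_lt with h | h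
  · simp [← h]
  · rw [mul_inv_le_iff₀ (by positivity), mul_add, mul_one, pow_two, inv_mul_cancel_left₀ h.ne']
    have := inv_pos.2 h
    linarith

lemma tendsto_integral_mul_nlapIter_logKernel {m : ℕ} (hm : 1 ≤ m)
    {v : EuclideanSpace ℝ (Fin (2 * m)) → ℝ} (hv : Integrable v)
    {x : EuclideanSpace ℝ (Fin (2 * m))} (hx : ContinuousAt v x) :
    Tendsto (fun c : ℝ => ∫ y, v y * nlapIter m (logKernel ((c⁻¹) ^ 2) x) y) atTop
      (𝓝 (logConst m * v x)) := by
  have hI := integral_bubble_pos hm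
  have hdecay := tendsto_norm_pow_mul_bubble hm (∫ z, bubble m z)⁻¹ (inv_pos.2 hI).le
  generalize hIdef : ∫ z, bubble m z = I at *
  have hT := tendsto_integral_comp_smul_smul_of_integrable' (μ := volume)
    (φ := fun z : EuclideanSpace ℝ (Fin (2 * m)) => I⁻¹ * bubble m z)
    (fun z => by have := bubble_pos m z; positivity)
    (by rw [integral_const_mul, hIdef, inv_mul_cancel₀ hI.ne']) hdecay hv hx
  have hT2 := hT.const_mul (logConst m)
  refine hT2.congr' ?_
  filter_upwards [eventually_gt_atTop 0] with c hc
  rw [← integral_const_mul]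
  refine integral_congr_ae (Eventually.of_forall fun y => ?_)
  simp only
  rw [nlapIter_logKernel hm (by positivity), finrank_euclideanSpace_fin, logConst, hIdef, bubble,
    norm_smul, Real.norm_of_nonneg hc.le, norm_sub_rev x y, smul_eq_mul]
  set r := ‖y - x‖
  have e : r ^ 2 + (c⁻¹) ^ 2 = (c⁻¹) ^ 2 * (1 + (c * r) ^ 2) := by field_simp; ring
  have e2 : ((c⁻¹) ^ 2) ^ m * (((c⁻¹) ^ 2)⁻¹) ^ (2 * m) = c ^ (2 * m) := by
    rw [← pow_mul, ← inv_pow, inv_inv, ← pow_mul, inv_pow, show 2 * (2 * m) = 2 * m + 2 * m by ring,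
      pow_add, inv_mul_cancel_left₀ (by positivity)]
  rw [e, mul_inv, mul_pow (((c⁻¹) ^ 2)⁻¹), ← mul_assoc (((c⁻¹) ^ 2) ^ m), e2]
  field_simp

/-- Representation formula near an isolated singularity. -/
theorem logConst_mul_eq {m : ℕ} (hm : 1 ≤ m) {v : EuclideanSpace ℝ (Fin (2 * m)) → ℝ}
    (hv : ∀ y ≠ 0, ContDiffAt ℝ ((2 * m : ℕ)) v y) (hc : HasCompactSupport v)
    (hvi : Integrable v) (hgi : Integrable (nlapIter m v))
    (ho : ∀ ε > (0 : ℝ), ∃ δ > (0 : ℝ), ∀ r : ℝ, 0 < r → r < δ →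
      ∫ y in ball 0 r, |v y| ≤ ε * r ^ (2 * m - 2))
    {x : EuclideanSpace ℝ (Fin (2 * m))} (hx : x ≠ 0) :
    logConst m * v x = (∫ y, nlapIter m v y * -Real.log ‖y - x‖) +
      (∫ y, nlapIter m v y) * Real.log ‖x‖ -
      (∫ y, nlapIter m v y * inner ℝ x y) / ‖x‖ ^ 2 := by
  have hgc : HasCompactSupport (nlapIter m v) :=
    hc.of_isClosed_subset (isClosed_tsupport _) (tsupport_nlapIter_subset m)
  have hgx : ContinuousAt (nlapIter m v) x :=
    (contDiffAt_nlapIter (k := 0) m (by simpa using hv x hx)).continuousAt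
  have hxn : 0 < ‖x‖ := norm_pos_iff.2 hx
  have key (t : ℝ) (ht : 0 < t) : ∫ y, v y * nlapIter m (logKernel t x) y =
      (∫ y, nlapIter m v y * logKernel t x y) - (∫ y, nlapIter m v y) * logKernel t x 0 -
      (∫ y, nlapIter m v y * inner ℝ x y) / (‖x‖ ^ 2 + t) := by
    have hK := contDiff_logKernel ht x
    set L := fderiv ℝ (logKernel t x) 0
    have hA : ContDiff ℝ ∞ (fun y => logKernel t x 0 + L y) := contDiff_const.add L.contDiff
    have h := integral_mul_nlapIter_of_jet_eq_zero hm hv hc hvi hgi ho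
      (ζ := logKernel t x - fun y => logKernel t x 0 + L y) (hK.sub hA) (by simp) (by
        rw [fderiv_sub (hK.differentiable (by simp) 0) (hA.differentiable (by simp) 0),
          fderiv_const_add, ContinuousLinearMap.fderiv, sub_self])
    rw [nlapIter_sub m hK hA, nlapIter_affine hm, sub_zero] at h
    rw [h]
    have i1 := integrable_mul_of_tsupport_bdd hgi hgc hK.continuous
    have i2 := integrable_mul_of_tsupport_bdd hgi hgc (f := fun y => inner ℝ x y) (by fun_prop)
    have e (y) : nlapIter m v y * (logKernel t x - fun y => logKernel t x 0 + L y) y =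
        nlapIter m v y * logKernel t x y - nlapIter m v y * logKernel t x 0 -
        nlapIter m v y * inner ℝ x y / (‖x‖ ^ 2 + t) := by
      simp only [Pi.sub_apply, L, fderiv_logKernel_zero ht]
      ring
    simp only [e]
    have i3 : Integrable (fun y => nlapIter m v y * logKernel t x y -
        nlapIter m v y * logKernel t x 0) := i1.sub (hgi.mul_const _)
    rw [integral_sub i3 (i2.div_const _), integral_sub i1 (hgi.mul_const _),
      integral_mul_const, integral_div]
  have hc0 : Tendsto (fun c : ℝ => ‖x‖ ^ 2 + (c⁻¹) ^ 2) atTop (𝓝 (‖x‖ ^ 2)) := by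
    have := (tendsto_const_nhds (x := ‖x‖ ^ 2)).add ((tendsto_inv_atTop_zero (𝕜 := ℝ)).pow 2)
    rwa [zero_pow two_ne_zero, add_zero] at this
  have hK0 : Tendsto (fun c : ℝ => logKernel ((c⁻¹) ^ 2) x 0) atTop (𝓝 (-Real.log ‖x‖)) := by
    have h2 := (hc0.log (by positivity)).const_mul (-(1 / 2))
    rw [Real.log_pow] at h2
    convert! h2 using 2
    · simp [logKernel]
    · push_cast; ring
  have hR := ((tendsto_integral_mul_logKernel (by omega) hgi hgc hgx).sub
    (hK0.const_mul (∫ y, nlapIter m v y))).sub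
    ((tendsto_const_nhds (x := ∫ y, nlapIter m v y * inner ℝ x y)).div hc0 (by positivity))
  have hL := tendsto_integral_mul_nlapIter_logKernel hm hvi (hv x hx).continuousAt
  have := tendsto_nhds_unique (hL.congr' (by
    filter_upwards [eventually_gt_atTop 0] with c hc using key _ (by positivity))) hR
  rw [this]
  ring

end Representation

section Localization

variable {m : ℕ}

lemma ball_diff_singleton_ae_eq (hm : 1 ≤ m) (s : Set (EuclideanSpace ℝ (Fin (2 * m)))) :
    (s \ {0} : Set (EuclideanSpace ℝ (Fin (2 * m)))) =ᵐ[volume] s := by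
  have : Nontrivial (EuclideanSpace ℝ (Fin (2 * m))) := by
    have : Nonempty (Fin (2 * m)) := ⟨⟨0, by omega⟩⟩
    infer_instance
  exact sdiff_null_ae_eq_self (measure_singleton 0)

lemma aestronglyMeasurable_of_continuousAt (hm : 1 ≤ m) {f : EuclideanSpace ℝ (Fin (2 * m)) → ℝ}
    (hf : ∀ y ≠ 0, ContinuousAt f y) : AEStronglyMeasurable f volume := by
  have h : ContinuousOn f (univ \ {0}) := fun y hy => (hf y (by simpa using hy)).continuousWithinAt
  have h1 := h.aestronglyMeasurable (μ := volume)
    (MeasurableSet.univ.diff (measurableSet_singleton 0))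
  rwa [Measure.restrict_congr_set (ball_diff_singleton_ae_eq hm univ), Measure.restrict_univ] at h1

lemma integrable_of_integrableOn_ball {f : EuclideanSpace ℝ (Fin (2 * m)) → ℝ}
    (hf : ∀ y ≠ 0, ContinuousAt f y) (hc : HasCompactSupport f) {r : ℝ} (hr : 0 < r)
    (hi : IntegrableOn f (ball 0 r)) : Integrable f := by
  have hne (y : EuclideanSpace ℝ (Fin (2 * m))) (hy : r ≤ ‖y‖) : y ≠ 0 := by
    rintro rfl
    rw [norm_zero] at hy
    linarith
  have h1 : IntegrableOn f (tsupport f \ ball 0 r) :=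
    ContinuousOn.integrableOn_compact (hc.isCompact.diff isOpen_ball)
      (fun y hy => (hf y (hne y (by simpa using hy.2))).continuousWithinAt)
  refine (integrableOn_iff_integrable_of_support_subset (s := ball 0 r ∪ (tsupport f \ ball 0 r))
    ?_).1 (hi.union h1)
  rw [union_sdiff_self]
  exact (subset_tsupport f).trans subset_union_right

/-- Cutting off a solution near an isolated singularity. -/
lemma exists_localization (hm : 1 ≤ m) {K u : EuclideanSpace ℝ (Fin (2 * m)) → ℝ} {M : ℝ}
    (hK0 : ∀ x ∈ ball (0 : EuclideanSpace ℝ (Fin (2 * m))) 1, 0 ≤ K x)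
    (hKM : ∀ x ∈ ball (0 : EuclideanSpace ℝ (Fin (2 * m))) 1, K x ≤ M)
    (hu : ContDiffOn ℝ (2 * m : ℕ) u (ball (0 : EuclideanSpace ℝ (Fin (2 * m))) 1 \ {0}))
    (heq : ∀ x ∈ ball (0 : EuclideanSpace ℝ (Fin (2 * m))) 1 \ {0},
      nlapIter m u x = K x * Real.exp (u x))
    (hint : IntegrableOn (fun x => Real.exp (u x))
      (ball (0 : EuclideanSpace ℝ (Fin (2 * m))) 1 \ {0}))
    (ho : ∀ ε > (0 : ℝ), ∃ δ > (0 : ℝ), ∀ r : ℝ, 0 < r → r < δ →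
      ∫⁻ x in ball (0 : EuclideanSpace ℝ (Fin (2 * m))) r \ {0}, (‖u x‖₊ : ℝ≥0∞)
        ≤ ENNReal.ofReal (ε * r ^ (2 * m - 2))) :
    ∃ v : EuclideanSpace ℝ (Fin (2 * m)) → ℝ, (∀ y ≠ 0, ContDiffAt ℝ (2 * m : ℕ) v y) ∧
      tsupport v ⊆ closedBall 0 (3 / 4) ∧ (∀ y ∈ ball 0 (1 / 2), v y = u y) ∧ Integrable v ∧
      Integrable (nlapIter m v) ∧
      (∀ ε > (0 : ℝ), ∃ δ > (0 : ℝ), ∀ r : ℝ, 0 < r → r < δ →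
        ∫ y in ball 0 r, |v y| ≤ ε * r ^ (2 * m - 2)) ∧
      (∀ y ∈ ball 0 (1 / 2), y ≠ 0 →
        0 ≤ nlapIter m v y ∧ nlapIter m v y ≤ |M| * Real.exp (u y)) ∧
      ∀ y ≠ 0, ContinuousAt (nlapIter m v) y := by
  let χ : ContDiffBump (0 : EuclideanSpace ℝ (Fin (2 * m))) :=
    ⟨1 / 2, 3 / 4, by norm_num, by norm_num⟩
  let v : EuclideanSpace ℝ (Fin (2 * m)) → ℝ := fun y => χ y * u y
  have hsupp : tsupport v ⊆ closedBall 0 (3 / 4) :=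
    (tsupport_mul_subset_left (f := χ) (g := u)).trans χ.tsupport_eq.subset
  have hc : HasCompactSupport v :=
    (isCompact_closedBall _ _).of_isClosed_subset (isClosed_tsupport _) hsupp
  have hopen : IsOpen (ball (0 : EuclideanSpace ℝ (Fin (2 * m))) 1 \ {0}) :=
    isOpen_ball.sdiff isClosed_singleton
  have hv (y : EuclideanSpace ℝ (Fin (2 * m))) (hy : y ≠ 0) : ContDiffAt ℝ (2 * m : ℕ) v y := by
    by_cases h : y ∈ ball 0 1
    · exact χ.contDiffAt.mul (hu.contDiffAt (hopen.mem_nhds ⟨h, by simpa using hy⟩))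
    · have : y ∉ tsupport v := fun h' => by
        have := hsupp h'
        simp only [mem_closedBall, mem_ball] at h this
        linarith
      exact contDiffAt_const.congr_of_eventuallyEq (notMem_tsupport_iff_eventuallyEq.1 this)
  have huv (y : EuclideanSpace ℝ (Fin (2 * m))) (hy : y ∈ ball 0 (1 / 2)) : v y = u y := by
    simp only [v]
    rw [χ.one_of_mem_closedBall (ball_subset_closedBall hy), one_mul]
  have hgc (y : EuclideanSpace ℝ (Fin (2 * m))) (hy : y ≠ 0) : ContinuousAt (nlapIter m v) y :=
    (contDiffAt_nlapIter (k := 0) m (by simpa using hv y hy)).continuousAt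
  have hgsupp : HasCompactSupport (nlapIter m v) :=
    hc.of_isClosed_subset (isClosed_tsupport _) (tsupport_nlapIter_subset m)
  have hg (y : EuclideanSpace ℝ (Fin (2 * m))) (hy : y ∈ ball 0 (1 / 2)) (hy0 : y ≠ 0) :
      0 ≤ nlapIter m v y ∧ nlapIter m v y ≤ |M| * Real.exp (u y) := by
    have h1 : y ∈ ball (0 : EuclideanSpace ℝ (Fin (2 * m))) 1 := ball_subset_ball (by norm_num) hy
    have h2 : v =ᶠ[𝓝 y] u := by
      filter_upwards [isOpen_ball.mem_nhds hy] with z hz using huv z hz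
    rw [(nlapIter_eventuallyEq m h2).eq_of_nhds, heq y ⟨h1, by simpa using hy0⟩]
    have := hK0 y h1
    have := (hKM y h1).trans (le_abs_self M)
    have := Real.exp_pos (u y)
    constructor
    · positivity
    · gcongr
  have hball (r : ℝ) : ∫⁻ y in ball 0 r, ‖v y‖ₑ ≤
      ∫⁻ x in ball (0 : EuclideanSpace ℝ (Fin (2 * m))) r \ {0}, (‖u x‖₊ : ℝ≥0∞) := by
    rw [← setLIntegral_congr (ball_diff_singleton_ae_eq hm (ball 0 r))]
    refine lintegral_mono fun y => ?_
    simp only [v, enorm_mul]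
    refine mul_le_of_le_one_left' ?_
    rw [Real.enorm_eq_ofReal χ.nonneg]
    exact ENNReal.ofReal_le_one.2 χ.le_one
  have hvm : AEStronglyMeasurable v volume :=
    aestronglyMeasurable_of_continuousAt hm fun y hy => (hv y hy).continuousAt
  refine ⟨v, hv, hsupp, huv, ?_, ?_, ?_, hg, hgc⟩
  · obtain ⟨δ, hδ, h⟩ := ho 1 one_pos
    refine integrable_of_integrableOn_ball (fun y hy => (hv y hy).continuousAt) hc (half_pos hδ)
      ⟨hvm.restrict, ?_⟩
    exact ((hball _).trans (h _ (half_pos hδ) (half_lt_self hδ))).trans_lt ENNReal.ofReal_lt_top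
  · refine integrable_of_integrableOn_ball hgc hgsupp one_half_pos ?_
    rw [← integrableOn_congr_set_ae (ball_diff_singleton_ae_eq hm _)]
    refine ((hint.mono_set (sdiff_subset_sdiff_left
      (ball_subset_ball (by norm_num)))).const_mul |M|).mono'
      (aestronglyMeasurable_of_continuousAt hm hgc).restrict ?_
    refine (ae_restrict_iff' (measurableSet_ball.diff (measurableSet_singleton 0))).2
      (Eventually.of_forall fun y hy => ?_)
    have := hg y hy.1 (by simpa using hy.2)
    rw [Real.norm_of_nonneg this.1]
    exact this.2
  · intro ε hε
    obtain ⟨δ, hδ, h⟩ := ho ε hε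
    refine ⟨δ, hδ, fun r hr hrδ => ?_⟩
    have := integral_norm_eq_lintegral_enorm (hvm.restrict (s := ball 0 r))
    simp only [Real.norm_eq_abs] at this
    rw [this]
    exact ENNReal.toReal_le_of_le_ofReal (by positivity) ((hball r).trans (h r hr hrδ))

end Localization

section Exponent

variable {m : ℕ}

lemma not_integrableOn_exp_of_le (hm : 1 ≤ m) {u : EuclideanSpace ℝ (Fin (2 * m)) → ℝ}
    (hint : IntegrableOn (fun x => Real.exp (u x))
      (ball (0 : EuclideanSpace ℝ (Fin (2 * m))) 1 \ {0}))
    {e : EuclideanSpace ℝ (Fin (2 * m))} (he : ‖e‖ = 1) {c : ℝ}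
    (h : ∀ r, 0 < r → r < 1 / 5 → ∀ x ∈ ball (r • e) (r / 4), c ≤ u x + (2 * m) * Real.log r) :
    False := by
  have hsub (r : ℝ) (hr : 0 < r) (hr5 : r < 1 / 5) : ball (r • e) (r / 4) ⊆
      ball (0 : EuclideanSpace ℝ (Fin (2 * m))) 1 \ {0} := by
    intro x hx
    rw [mem_ball, dist_eq_norm] at hx
    have h1 : ‖r • e‖ = r := by rw [norm_smul, he, mul_one, Real.norm_of_nonneg hr.le]
    have h2 := norm_sub_norm_le x (r • e)
    have h3 := norm_sub_norm_le (r • e) x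
    rw [norm_sub_rev] at h3
    refine ⟨by rw [mem_ball_zero_iff]; linarith, fun h0 => ?_⟩
    rw [mem_singleton_iff.1 h0, zero_sub, norm_neg] at hx
    linarith
  have hvol (r : ℝ) (hr : 0 < r) : volume.real (ball (r • e) (r / 4)) =
      (r / 4) ^ (2 * m) * volume.real (ball (0 : EuclideanSpace ℝ (Fin (2 * m))) 1) := by
    rw [Measure.real, Measure.addHaar_ball_of_pos _ _ (by positivity), ENNReal.toReal_mul,
      ENNReal.toReal_ofReal (by positivity), finrank_euclideanSpace_fin, Measure.real]
  set V := volume.real (ball (0 : EuclideanSpace ℝ (Fin (2 * m))) 1)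
  have hV : 0 < V := ENNReal.toReal_pos (measure_ball_pos _ _ one_pos).ne' measure_ball_lt_top.ne
  have hlow (r : ℝ) (hr : 0 < r) (hr5 : r < 1 / 5) : Real.exp c * (1 / 4) ^ (2 * m) * V ≤
      ∫ x in ball (r • e) (r / 4), Real.exp (u x) := by
    have h1 : ∫ _ in ball (r • e) (r / 4), Real.exp c * (r ^ (2 * m))⁻¹ ≤
        ∫ x in ball (r • e) (r / 4), Real.exp (u x) := by
      refine setIntegral_mono_on (integrableOn_const measure_ball_lt_top.ne)
        (hint.mono_set (hsub r hr hr5)) measurableSet_ball fun x hx => ?_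
      rw [mul_inv_le_iff₀ (by positivity)]
      have := Real.exp_le_exp.2 (h r hr hr5 x hx)
      rw [Real.exp_add] at this
      refine this.trans_eq (congrArg _ ?_)
      rw [mul_comm _ (Real.log r), Real.exp_mul, Real.exp_log hr, ← Real.rpow_natCast]
      push_cast
      rfl
    rw [setIntegral_const, hvol r hr, smul_eq_mul, div_pow] at h1
    refine le_trans (le_of_eq ?_) h1
    rw [one_div, inv_pow]
    field_simp
  have hlim : Tendsto (fun r : ℝ => ∫ x in ball (r • e) (r / 4), Real.exp (u x)
      ∂(volume.restrict (ball (0 : EuclideanSpace ℝ (Fin (2 * m))) 1 \ {0}))) (𝓝[>] 0) (𝓝 0) := by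
    refine hint.tendsto_setIntegral_nhds_zero ?_
    refine tendsto_of_tendsto_of_tendsto_of_le_of_le' tendsto_const_nhds
      (h := fun r => ENNReal.ofReal ((r / 4) ^ (2 * m) * V)) ?_
      (Eventually.of_forall fun _ => zero_le) ?_
    · have : Tendsto (fun r : ℝ => ENNReal.ofReal ((r / 4) ^ (2 * m) * V)) (𝓝 0)
          (𝓝 (ENNReal.ofReal ((0 / 4) ^ (2 * m) * V))) :=
        (ENNReal.continuous_ofReal.comp (by fun_prop)).tendsto 0
      rw [zero_div, zero_pow (by omega), zero_mul, ENNReal.ofReal_zero] at this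
      exact this.mono_left nhdsWithin_le_nhds
    · filter_upwards [self_mem_nhdsWithin] with r hr
      rw [← hvol r hr, ofReal_measureReal measure_ball_lt_top.ne]
      exact Measure.restrict_apply_le _ _
  have hpos : 0 < Real.exp c * (1 / 4) ^ (2 * m) * V := by positivity
  have hev : ∀ᶠ r : ℝ in 𝓝[>] 0, 0 < r ∧ r < 1 / 5 :=
    (eventually_mem_nhdsWithin (a := (0 : ℝ)) (s := Ioi 0)).and
      (nhdsWithin_le_nhds (gt_mem_nhds (by norm_num)))
  obtain ⟨r, ⟨hr, hr5⟩, h2⟩ := (hev.and (hlim.eventually (gt_mem_nhds hpos))).exists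
  have h3 := hlow r hr hr5
  rw [Measure.restrict_restrict measurableSet_ball,
    inter_eq_left.2 (hsub r hr hr5)] at h2
  linarith

lemma exists_le_mul_log_add_div (a : ℝ) {β : ℝ} (hβ : 0 < β) :
    ∃ c, ∀ r, 0 < r → r < 1 → c ≤ a * Real.log r + β / r := by
  rcases le_or_gt a 0 with ha | ha
  · refine ⟨0, fun r hr hr1 => ?_⟩
    have := mul_nonneg_of_nonpos_of_nonpos ha (Real.log_nonpos hr.le hr1.le)
    positivity
  · refine ⟨-(a * Real.log (a / β)), fun r hr hr1 => ?_⟩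
    have h1 := Real.log_le_self (by positivity : 0 ≤ β / (a * r))
    have h2 : Real.log (β / (a * r)) = -Real.log (a / β) - Real.log r := by
      rw [← Real.log_inv, inv_div, ← Real.log_div (by positivity) hr.ne', div_div]
    rw [h2] at h1
    have h3 : a * (β / (a * r)) = β / r := by field_simp
    nlinarith

lemma eq_zero_and_lt_of_integrableOn_exp (hm : 1 ≤ m) {u : EuclideanSpace ℝ (Fin (2 * m)) → ℝ}
    (hint : IntegrableOn (fun x => Real.exp (u x))
      (ball (0 : EuclideanSpace ℝ (Fin (2 * m))) 1 \ {0})) {α c : ℝ}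
    {b : EuclideanSpace ℝ (Fin (2 * m))}
    (h : ∀ x, 0 < ‖x‖ → ‖x‖ < 1 / 4 → c + α * Real.log ‖x‖ - inner ℝ x b / ‖x‖ ^ 2 ≤ u x) :
    b = 0 ∧ -(2 * m : ℝ) < α := by
  have key (e : EuclideanSpace ℝ (Fin (2 * m))) (he : ‖e‖ = 1) (d : ℝ)
      (hd : ∀ r, 0 < r → r < 1 / 5 → ∀ x ∈ ball (r • e) (r / 4),
        d ≤ (α + 2 * m) * Real.log r - inner ℝ x b / ‖x‖ ^ 2) : False := by
    refine not_integrableOn_exp_of_le hm hint he (c := c - |α| * Real.log 2 + d)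
      fun r hr hr5 x hx => ?_
    have hd' := hd r hr hr5 x hx
    rw [mem_ball, dist_eq_norm] at hx
    have h1 : ‖r • e‖ = r := by rw [norm_smul, he, mul_one, Real.norm_of_nonneg hr.le]
    have h2 := norm_sub_norm_le x (r • e)
    have h3 := norm_sub_norm_le (r • e) x
    rw [norm_sub_rev] at h3
    have hx0 : 0 < ‖x‖ := by linarith
    have h4 := h x hx0 (by linarith)
    have h5 : |Real.log ‖x‖ - Real.log r| ≤ Real.log 2 := by
      rw [abs_le, ← Real.log_div hx0.ne' hr.ne', ← Real.log_inv]
      constructor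
      · refine Real.log_le_log (by norm_num) ?_
        rw [le_div_iff₀ hr]
        linarith
      · refine Real.log_le_log (by positivity) ?_
        rw [div_le_iff₀ hr]
        linarith
    have h6 : -(|α| * Real.log 2) ≤ α * (Real.log ‖x‖ - Real.log r) := by
      refine le_trans (neg_le_neg ?_) (neg_abs_le _)
      rw [abs_mul]
      gcongr
    linarith
  by_contra hcon
  by_cases hb : b = 0
  · have hα : α ≤ -(2 * m : ℝ) := not_lt.1 fun h' => hcon ⟨hb, h'⟩
    refine key (EuclideanSpace.single ⟨0, by omega⟩ 1) (by simp) 0 fun r hr hr5 x _ => ?_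
    rw [hb, inner_zero_right, zero_div, sub_zero]
    exact mul_nonneg_of_nonpos_of_nonpos (by linarith) (Real.log_nonpos hr.le (by linarith))
  · have hb' : 0 < ‖b‖ := norm_pos_iff.2 hb
    obtain ⟨d, hd⟩ := exists_le_mul_log_add_div (α + 2 * m) (β := 12 / 25 * ‖b‖) (by positivity)
    have he : ‖-(‖b‖⁻¹ • b)‖ = 1 := by
      rw [norm_neg, norm_smul, norm_inv, norm_norm, inv_mul_cancel₀ hb'.ne']
    refine key (-(‖b‖⁻¹ • b)) he d fun r hr hr5 x hx => ?_
    refine (hd r hr (by linarith)).trans ?_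
    rw [mem_ball, dist_eq_norm] at hx
    have h1 : ‖r • -(‖b‖⁻¹ • b)‖ = r := by
      rw [norm_smul, he, mul_one, Real.norm_of_nonneg hr.le]
    have h2 := norm_sub_norm_le x (r • -(‖b‖⁻¹ • b))
    have h3 := norm_sub_norm_le (r • -(‖b‖⁻¹ • b)) x
    rw [norm_sub_rev] at h3
    have hx0 : 0 < ‖x‖ := by linarith
    have h4 : inner ℝ x b = inner ℝ (x - r • -(‖b‖⁻¹ • b)) b - r * ‖b‖ := by
      rw [inner_sub_left, real_inner_smul_left, inner_neg_left, real_inner_smul_left,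
        real_inner_self_eq_norm_sq]
      field_simp
      ring
    have h5 := real_inner_le_norm (x - r • -(‖b‖⁻¹ • b)) b
    have h6 : ‖x - r • -(‖b‖⁻¹ • b)‖ * ‖b‖ ≤ r / 4 * ‖b‖ := by gcongr
    have h7 : inner ℝ x b ≤ -(3 / 4 * r * ‖b‖) := by linarith
    have h8 : 12 / 25 * ‖b‖ / r ≤ 3 / 4 * r * ‖b‖ / ‖x‖ ^ 2 := by
      rw [div_le_div_iff₀ hr (by positivity)]
      have : ‖x‖ ^ 2 ≤ (5 / 4 * r) ^ 2 := by
        gcongr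
        linarith
      nlinarith
    have h9 : inner ℝ x b / ‖x‖ ^ 2 ≤ -(3 / 4 * r * ‖b‖) / ‖x‖ ^ 2 := by gcongr
    rw [neg_div] at h9
    linarith

/-- The logarithmic potential of a density. -/
def logPot {n : ℕ} (g : EuclideanSpace ℝ (Fin n) → ℝ) (x : EuclideanSpace ℝ (Fin n)) : ℝ :=
  ∫ y, g y * -Real.log ‖y - x‖

lemma le_logPot (hm : 1 ≤ m) {g : EuclideanSpace ℝ (Fin (2 * m)) → ℝ} (hg : Integrable g)
    (hs : tsupport g ⊆ closedBall 0 (3 / 4)) (h0 : ∀ y ∈ ball 0 (1 / 2), y ≠ 0 → 0 ≤ g y)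
    {x : EuclideanSpace ℝ (Fin (2 * m))} (hgx : ContinuousAt g x) (hx : ‖x‖ < 1 / 4) :
    -((∫ y, |g y|) * Real.log 4) ≤ logPot g x := by
  have hc : HasCompactSupport g :=
    (isCompact_closedBall _ _).of_isClosed_subset (isClosed_tsupport _) hs
  have hi := (integrable_mul_log_norm_sub (by omega) hg hc hgx).neg
  rw [← integral_mul_const, ← integral_neg]
  refine integral_mono_ae (hg.abs.mul_const _).neg (by simpa using hi) ?_
  have : Nontrivial (EuclideanSpace ℝ (Fin (2 * m))) := by
    have : Nonempty (Fin (2 * m)) := ⟨⟨0, by omega⟩⟩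
    infer_instance
  have hae : ∀ᵐ y : EuclideanSpace ℝ (Fin (2 * m)), y ≠ 0 :=
    (measure_eq_zero_iff_ae_notMem.1 (measure_singleton 0)).mono fun y hy => by simpa using hy
  filter_upwards [hae] with y hy
  have hl4 : 0 ≤ Real.log 4 := Real.log_nonneg (by norm_num)
  by_cases hy2 : y ∈ ball 0 (1 / 2)
  · have h1 := h0 y hy2 hy
    have h2 : ‖y - x‖ ≤ 1 := (norm_sub_le _ _).trans (by
      rw [mem_ball_zero_iff] at hy2
      linarith)
    have h3 := Real.log_nonpos (norm_nonneg _) h2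
    have h4 : 0 ≤ g y * -Real.log ‖y - x‖ := mul_nonneg h1 (by linarith)
    have h5 := mul_nonneg (abs_nonneg (g y)) hl4
    linarith
  · by_cases hys : y ∈ tsupport g
    · have h1 := hs hys
      rw [mem_closedBall_zero_iff] at h1
      rw [mem_ball_zero_iff, not_lt] at hy2
      have h2 := norm_sub_le y x
      have h3 := norm_sub_norm_le y x
      have h4 : |Real.log ‖y - x‖| ≤ Real.log 4 := by
        rw [abs_le, ← Real.log_inv]
        constructor
        · exact Real.log_le_log (by norm_num) (by linarith)
        · exact Real.log_le_log (by linarith) (by linarith)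
      refine le_trans (neg_le_neg ?_) (neg_abs_le _)
      rw [abs_mul, abs_neg]
      gcongr
    · simp [image_eq_zero_of_notMem_tsupport hys]

/-- The representation formula with the singular part identified. -/
theorem exists_eq_mul_log_add_logPot (hm : 1 ≤ m)
    {K u : EuclideanSpace ℝ (Fin (2 * m)) → ℝ} {M : ℝ}
    (hK0 : ∀ x ∈ ball (0 : EuclideanSpace ℝ (Fin (2 * m))) 1, 0 ≤ K x)
    (hKM : ∀ x ∈ ball (0 : EuclideanSpace ℝ (Fin (2 * m))) 1, K x ≤ M)
    (hu : ContDiffOn ℝ (2 * m : ℕ) u (ball (0 : EuclideanSpace ℝ (Fin (2 * m))) 1 \ {0}))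
    (heq : ∀ x ∈ ball (0 : EuclideanSpace ℝ (Fin (2 * m))) 1 \ {0},
      nlapIter m u x = K x * Real.exp (u x))
    (hint : IntegrableOn (fun x => Real.exp (u x))
      (ball (0 : EuclideanSpace ℝ (Fin (2 * m))) 1 \ {0}))
    (ho : ∀ ε > (0 : ℝ), ∃ δ > (0 : ℝ), ∀ r : ℝ, 0 < r → r < δ →
      ∫⁻ x in ball (0 : EuclideanSpace ℝ (Fin (2 * m))) r \ {0}, (‖u x‖₊ : ℝ≥0∞)
        ≤ ENNReal.ofReal (ε * r ^ (2 * m - 2))) :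
    ∃ g : EuclideanSpace ℝ (Fin (2 * m)) → ℝ, ∃ α : ℝ, -(2 * m : ℝ) < α ∧ Integrable g ∧
      tsupport g ⊆ closedBall 0 (3 / 4) ∧ (∀ y ≠ 0, ContinuousAt g y) ∧
      (∀ y ∈ ball 0 (1 / 2), y ≠ 0 → 0 ≤ g y ∧ g y ≤ |M| * Real.exp (u y)) ∧
      ∀ y ∈ ball 0 (1 / 2), y ≠ 0 → u y = α * Real.log ‖y‖ + (logConst m)⁻¹ * logPot g y := by
  obtain ⟨v, hv, hsupp, huv, hvi, hgi, hov, hg, hgc⟩ :=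
    exists_localization hm hK0 hKM hu heq hint ho
  set g := nlapIter m v with hgdef
  have hsg : tsupport g ⊆ closedBall 0 (3 / 4) := (tsupport_nlapIter_subset m).trans hsupp
  have hc : HasCompactSupport v :=
    (isCompact_closedBall _ _).of_isClosed_subset (isClosed_tsupport _) hsupp
  have hcg : HasCompactSupport g :=
    (isCompact_closedBall _ _).of_isClosed_subset (isClosed_tsupport _) hsg
  have hC := logConst_pos hm
  set C := logConst m
  have hb (x : EuclideanSpace ℝ (Fin (2 * m))) :
      ∫ y, g y * inner ℝ x y = inner ℝ x (∫ y, g y • y) := by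
    rw [← integral_inner]
    · simp only [real_inner_smul_right]
    · have hms : AEStronglyMeasurable (fun y => g y • y) volume :=
        hgi.aestronglyMeasurable.smul continuous_id.aestronglyMeasurable
      rw [← integrable_norm_iff hms]
      simpa [norm_smul, abs_mul] using
        (integrable_mul_of_tsupport_bdd hgi hcg (f := fun y => ‖y‖) (by fun_prop)).norm
  have hrep (x : EuclideanSpace ℝ (Fin (2 * m))) (hx : x ∈ ball 0 (1 / 2)) (hx0 : x ≠ 0) :
      u x = (C⁻¹ * ∫ y, g y) * Real.log ‖x‖ + C⁻¹ * logPot g x -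
        inner ℝ x (C⁻¹ • ∫ y, g y • y) / ‖x‖ ^ 2 := by
    have h := logConst_mul_eq hm hv hc hvi hgi hov hx0
    rw [huv x hx, hb] at h
    rw [real_inner_smul_right, logPot]
    have : u x = C⁻¹ * (C * u x) := (inv_mul_cancel_left₀ hC.ne' _).symm
    rw [this, h]
    ring
  obtain ⟨h1, h2⟩ := eq_zero_and_lt_of_integrableOn_exp hm hint (α := C⁻¹ * ∫ y, g y)
    (b := C⁻¹ • ∫ y, g y • y) (c := C⁻¹ * -((∫ y, |g y|) * Real.log 4)) fun x hx hx4 => by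
      have hx0 : x ≠ 0 := norm_pos_iff.1 hx
      rw [hrep x (by rw [mem_ball_zero_iff]; linarith) hx0]
      have h3 := le_logPot hm hgi hsg (fun y hy hy0 => (hg y hy hy0).1) (hgc x hx0) hx4
      have h4 := mul_le_mul_of_nonneg_left h3 (inv_pos.2 hC).le
      linarith
  refine ⟨g, _, h2, hgi, hsg, hgc, hg, fun y hy hy0 => ?_⟩
  rw [hrep y hy hy0, h1]
  simp

end Exponent

section HigherIntegrability

lemma exp_integral_mul_le {X : Type*} [MeasurableSpace X] {μ : Measure X} {w l : X → ℝ}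
    (hw0 : 0 ≤ᵐ[μ] w) (hw : Integrable w μ) (hw1 : ∫ y, w y ∂μ ≤ 1)
    (hwl : Integrable (fun y => w y * l y) μ) (hwe : Integrable (fun y => w y * Real.exp (l y)) μ) :
    Real.exp (∫ y, w y * l y ∂μ) ≤ (∫ y, w y * Real.exp (l y) ∂μ) + 1 := by
  set t := ∫ y, w y * l y ∂μ
  set W := ∫ y, w y ∂μ
  have hW : 0 ≤ W := integral_nonneg_of_ae hw0
  have h1 : ∫ y, (Real.exp t * (w y * l y) + Real.exp t * (1 - t) * w y) ∂μ ≤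
      ∫ y, w y * Real.exp (l y) ∂μ := by
    refine integral_mono_ae ((hwl.const_mul _).add (hw.const_mul _)) hwe ?_
    filter_upwards [hw0] with y hy
    have h2 := mul_le_mul_of_nonneg_left (Real.add_one_le_exp (l y - t)) (Real.exp_pos t).le
    rw [← Real.exp_add, add_sub_cancel] at h2
    have h3 := mul_le_mul_of_nonneg_left h2 hy
    linarith
  rw [integral_add (hwl.const_mul _) (hw.const_mul _), integral_const_mul,
    integral_const_mul] at h1
  have h4 : Real.exp t * (1 - t) ≤ 1 := by
    have := mul_le_mul_of_nonneg_left (Real.add_one_le_exp (-t)) (Real.exp_pos t).le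
    rw [← Real.exp_add, add_neg_cancel, Real.exp_zero] at this
    linarith
  have h5 := mul_le_mul_of_nonneg_left h4 (sub_nonneg.2 hw1)
  change Real.exp t * t + Real.exp t * (1 - t) * W ≤ _ at h1
  linarith

lemma rpow_neg_mul_rpow_neg_le {r s a b : ℝ} (hr : 0 < r) (hs : 0 < s) (ha : 0 ≤ a) (hb : 0 ≤ b) :
    r ^ (-a) * s ^ (-b) ≤ r ^ (-(a + b)) + s ^ (-(a + b)) := by
  rw [neg_add]
  rcases le_total r s with h | h
  · have h1 : s ^ (-b) ≤ r ^ (-b) := Real.rpow_le_rpow_of_nonpos hr h (by linarith)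
    have h2 : r ^ (-a) * s ^ (-b) ≤ r ^ (-a + -b) := by
      rw [Real.rpow_add hr]
      gcongr
    have h3 : 0 ≤ s ^ (-a + -b) := by positivity
    linarith
  · have h1 : r ^ (-a) ≤ s ^ (-a) := Real.rpow_le_rpow_of_nonpos hs h (by linarith)
    have h2 : r ^ (-a) * s ^ (-b) ≤ s ^ (-a + -b) := by
      rw [Real.rpow_add hs]
      gcongr
    have h3 : 0 ≤ r ^ (-a + -b) := by positivity
    linarith

variable {m : ℕ}

lemma exists_setIntegral_ball_le (hm : 1 ≤ m) {g : EuclideanSpace ℝ (Fin (2 * m)) → ℝ}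
    (hg : Integrable g) {ε : ℝ} (hε : 0 < ε) :
    ∃ ρ, 0 < ρ ∧ ρ ≤ 1 / 4 ∧ ∫ y in ball 0 ρ, g y ≤ ε := by
  have h : Tendsto (fun r : ℝ => ∫ y in ball 0 r, g y) (𝓝[>] 0) (𝓝 0) := by
    refine hg.tendsto_setIntegral_nhds_zero ?_
    have : Tendsto (fun r : ℝ => ENNReal.ofReal (r ^ (2 * m)) *
        volume (ball (0 : EuclideanSpace ℝ (Fin (2 * m))) 1)) (𝓝 0)
        (𝓝 (ENNReal.ofReal (0 ^ (2 * m)) *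
          volume (ball (0 : EuclideanSpace ℝ (Fin (2 * m))) 1))) :=
      ENNReal.Tendsto.mul_const
        ((ENNReal.continuous_ofReal.comp (by fun_prop)).tendsto 0) (Or.inr measure_ball_lt_top.ne)
    rw [zero_pow (by omega), ENNReal.ofReal_zero, zero_mul] at this
    refine (this.mono_left nhdsWithin_le_nhds).congr' ?_
    filter_upwards [self_mem_nhdsWithin] with r hr
    rw [Function.comp_apply, Measure.addHaar_ball_of_pos _ _ hr, finrank_euclideanSpace_fin]
  have hev : ∀ᶠ r : ℝ in 𝓝[>] 0, 0 < r ∧ r < 1 / 4 :=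
    (eventually_mem_nhdsWithin (a := (0 : ℝ)) (s := Ioi 0)).and
      (nhdsWithin_le_nhds (gt_mem_nhds (by norm_num)))
  obtain ⟨r, ⟨h1, h2⟩, h3⟩ := (hev.and (h.eventually (gt_mem_nhds hε))).exists
  exact ⟨r, h1, h2.le, h3.le⟩

/-- The kernel `‖z‖ ^ (-s)` cut off at the unit sphere. -/
def rieszKer {n : ℕ} (s : ℝ) : EuclideanSpace ℝ (Fin n) → ℝ :=
  (ball 0 1).indicator fun z => ‖z‖ ^ (-s)

lemma integrable_rieszKer {n : ℕ} {s : ℝ} (hs : s < n) :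
    Integrable (rieszKer s : EuclideanSpace ℝ (Fin n) → ℝ) := by
  have := integrableOn_norm_sub_rpow hs (0 : EuclideanSpace ℝ (Fin n)) 1
  simp only [sub_zero] at this
  exact (integrable_indicator_iff measurableSet_ball).2 this

lemma rieszKer_nonneg {n : ℕ} (s : ℝ) (z : EuclideanSpace ℝ (Fin n)) : 0 ≤ rieszKer s z :=
  indicator_nonneg (fun _ _ => by positivity) z

lemma rieszKer_of_norm_lt {n : ℕ} (s : ℝ) {z : EuclideanSpace ℝ (Fin n)} (hz : ‖z‖ < 1) :
    rieszKer s z = ‖z‖ ^ (-s) :=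
  indicator_of_mem (by simpa using hz) _

lemma integrable_prod_rieszKer {n : ℕ} {s : ℝ} (hs : s < n) {g : EuclideanSpace ℝ (Fin n) → ℝ}
    (hg : Integrable g) : Integrable (fun p : EuclideanSpace ℝ (Fin n) × EuclideanSpace ℝ (Fin n) =>
      |g p.2| * (rieszKer s p.1 + rieszKer s (p.1 - p.2))) (volume.prod volume) := by
  have h1 := (integrable_rieszKer hs).mul_prod (μ := volume) (ν := volume) hg.abs
  have h2 := Integrable.convolution_integrand (ContinuousLinearMap.mul ℝ ℝ) (μ := volume)
    (ν := volume) hg.abs (integrable_rieszKer hs)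
  refine (h1.add h2).congr (Eventually.of_forall fun p => ?_)
  simp only [Pi.add_apply, ContinuousLinearMap.mul_apply']
  ring

lemma exp_mul_setIntegral_log_le (hm : 1 ≤ m) {g : EuclideanSpace ℝ (Fin (2 * m)) → ℝ}
    (hg : Integrable g) (hc : HasCompactSupport g) {c κ ρ : ℝ} (hc0 : 0 < c) (hκ : 0 < κ)
    (hκm : κ < 2 * m) (h0 : ∀ y ∈ ball 0 ρ, y ≠ 0 → 0 ≤ g y) (hρ : ∫ y in ball 0 ρ, g y ≤ κ / c)
    {x : EuclideanSpace ℝ (Fin (2 * m))} (hx : ContinuousAt g x) :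
    Real.exp (c * ∫ y in ball 0 ρ, g y * -Real.log ‖y - x‖) ≤
      (∫ y in ball 0 ρ, c / κ * g y * ‖y - x‖ ^ (-κ)) + 1 := by
  have : Nontrivial (EuclideanSpace ℝ (Fin (2 * m))) := by
    have : Nonempty (Fin (2 * m)) := ⟨⟨0, by omega⟩⟩
    infer_instance
  have hae (z : EuclideanSpace ℝ (Fin (2 * m))) :
      ∀ᵐ y ∂(volume.restrict (ball (0 : EuclideanSpace ℝ (Fin (2 * m))) ρ)), y ≠ z :=
    ae_restrict_of_ae ((measure_eq_zero_iff_ae_notMem.1 (measure_singleton z)).mono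
      fun y hy => by simpa using hy)
  have hexp : (fun y => c / κ * g y * Real.exp (-κ * Real.log ‖y - x‖)) =ᵐ[volume.restrict
      (ball (0 : EuclideanSpace ℝ (Fin (2 * m))) ρ)] fun y => c / κ * g y * ‖y - x‖ ^ (-κ) := by
    filter_upwards [hae x] with y hy
    rw [Real.rpow_def_of_pos (norm_pos_iff.2 (sub_ne_zero.2 hy)), mul_comm (-κ)]
  have hint1 : Integrable (fun y => c / κ * g y * (-κ * Real.log ‖y - x‖))
      (volume.restrict (ball (0 : EuclideanSpace ℝ (Fin (2 * m))) ρ)) := by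
    refine (((integrable_mul_log_norm_sub (by omega) hg hc hx).const_mul (-c)).restrict).congr
      (Eventually.of_forall fun y => ?_)
    simp only
    field_simp
  have hint2 : Integrable (fun y => c / κ * g y * Real.exp (-κ * Real.log ‖y - x‖))
      (volume.restrict (ball (0 : EuclideanSpace ℝ (Fin (2 * m))) ρ)) := by
    refine Integrable.congr ?_ hexp.symm
    refine (((integrable_mul_norm_sub_rpow hg hx hκ.le (by push_cast; exact hκm)).const_mul
      (c / κ)).restrict).congr (Eventually.of_forall fun y => ?_)
    simp only
    ring
  have h := exp_integral_mul_le (μ := volume.restrict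
    (ball (0 : EuclideanSpace ℝ (Fin (2 * m))) ρ)) (w := fun y => c / κ * g y)
    (l := fun y => -κ * Real.log ‖y - x‖) (by
      filter_upwards [hae 0, ae_restrict_mem measurableSet_ball] with y hy hyb
      have := h0 y hyb hy
      simp only [Pi.zero_apply]
      positivity) (hg.restrict.const_mul _) (by
      rw [integral_const_mul]
      calc c / κ * ∫ y in ball 0 ρ, g y ≤ c / κ * (κ / c) := by gcongr
        _ = 1 := by field_simp) hint1 hint2
  rw [integral_congr_ae hexp] at h
  convert! h using 2
  rw [← integral_const_mul]
  congr 1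
  ext y
  field_simp

lemma setIntegral_compl_log_le {g : EuclideanSpace ℝ (Fin (2 * m)) → ℝ}
    (hg : Integrable g) (hs : tsupport g ⊆ closedBall 0 (3 / 4)) {ρ : ℝ} (hρ0 : 0 < ρ)
    (hρ : ρ ≤ 1 / 4) {x : EuclideanSpace ℝ (Fin (2 * m))} (hx : ‖x‖ < ρ / 2) :
    ∫ y in (ball 0 ρ)ᶜ, g y * -Real.log ‖y - x‖ ≤ (∫ y, |g y|) * Real.log (2 / ρ) := by
  have hl : 0 ≤ Real.log (2 / ρ) := Real.log_nonneg (by rw [le_div_iff₀ hρ0]; linarith)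
  refine (Real.le_norm_self _).trans ((norm_integral_le_integral_norm _).trans ?_)
  rw [← integral_mul_const]
  refine le_trans ?_ (setIntegral_le_integral (s := (ball 0 ρ)ᶜ) (hg.abs.mul_const _)
    (Eventually.of_forall fun y => mul_nonneg (abs_nonneg _) hl))
  refine integral_mono_of_nonneg (Eventually.of_forall fun y => norm_nonneg _)
    (hg.abs.mul_const _).restrict ?_
  filter_upwards [ae_restrict_mem measurableSet_ball.compl] with y hy
  rw [norm_mul, Real.norm_eq_abs, Real.norm_eq_abs, abs_neg]
  by_cases hys : y ∈ tsupport g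
  · have h1 := hs hys
    rw [mem_closedBall_zero_iff] at h1
    rw [mem_compl_iff, mem_ball_zero_iff, not_lt] at hy
    have h2 := norm_sub_le y x
    have h3 := norm_sub_norm_le y x
    have h4 : |Real.log ‖y - x‖| ≤ Real.log (2 / ρ) := by
      rw [abs_le]
      constructor
      · rw [← Real.log_inv, inv_div]
        exact Real.log_le_log (by positivity) (by linarith)
      · refine Real.log_le_log (by linarith) ?_
        rw [le_div_iff₀ hρ0]
        nlinarith
    gcongr
  · simp [image_eq_zero_of_notMem_tsupport hys]

theorem exists_integrable_rpow (hm : 1 ≤ m) {g : EuclideanSpace ℝ (Fin (2 * m)) → ℝ}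
    (hg : Integrable g) (hs : tsupport g ⊆ closedBall 0 (3 / 4))
    (hgc : ∀ y ≠ 0, ContinuousAt g y) {M α c : ℝ} (hM : 0 ≤ M) (hα : -(2 * m : ℝ) < α) (hc : 0 < c)
    (h0 : ∀ y ∈ ball 0 (1 / 2), y ≠ 0 → 0 ≤ g y)
    (hle : ∀ y ∈ ball 0 (1 / 2), y ≠ 0 →
      g y ≤ M * Real.exp (α * Real.log ‖y‖ + c * logPot g y)) :
    ∃ q : ℝ, 1 < q ∧ Integrable fun y => |g y| ^ q := by
  have hm' : (1 : ℝ) ≤ m := by exact_mod_cast hm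
  obtain ⟨a, ha0, haα, ham⟩ : ∃ a : ℝ, 0 ≤ a ∧ -a ≤ α ∧ a < 2 * m :=
    ⟨max (-α) 0, le_max_right _ _, by linarith [le_max_left (-α) 0],
      max_lt (by linarith) (by linarith)⟩
  obtain ⟨q, hq1, hqm⟩ : ∃ q : ℝ, 1 < q ∧ a * q < 2 * m := by
    refine ⟨1 + (2 * m - a) / (4 * m), ?_, ?_⟩
    · have : 0 < (2 * m - a) / (4 * m) := div_pos (by linarith) (by linarith)
      linarith
    · have : a * ((2 * m - a) / (4 * m)) ≤ (2 * m - a) / 2 := by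
        rw [mul_div_assoc', div_le_div_iff₀ (by linarith) (by norm_num)]
        nlinarith
      linarith
  have hq0 : 0 < q := by linarith
  set κ := (2 * m - a * q) / 2 with hκdef
  have hκ : 0 < κ := by
    rw [hκdef]
    linarith
  have haq : 0 ≤ a * q := by positivity
  have hcg : HasCompactSupport g :=
    (isCompact_closedBall _ _).of_isClosed_subset (isClosed_tsupport _) hs
  obtain ⟨ρ, hρ0, hρ4, hρ⟩ := exists_setIntegral_ball_le hm hg
    (ε := κ / (q * c)) (by positivity)
  set s := a * q + κ with hsdef
  have hsm : s < (2 * m : ℕ) := by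
    push_cast
    linarith
  have hF := integrable_prod_rieszKer hsm hg
  set J : EuclideanSpace ℝ (Fin (2 * m)) → ℝ :=
    fun x => ∫ y, |g y| * (rieszKer s x + rieszKer s (x - y)) with hJ
  have hJi : Integrable J := hF.integral_prod_left
  have hslice := hF.prod_right_ae
  set D := (∫ y, |g y|) * Real.log (2 / ρ) with hD
  have : Nontrivial (EuclideanSpace ℝ (Fin (2 * m))) := by
    have : Nonempty (Fin (2 * m)) := ⟨⟨0, by omega⟩⟩
    infer_instance
  have hae (z : EuclideanSpace ℝ (Fin (2 * m))) :
      ∀ᵐ y : EuclideanSpace ℝ (Fin (2 * m)), y ≠ z :=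
    (measure_eq_zero_iff_ae_notMem.1 (measure_singleton z)).mono fun y hy => by simpa using hy
  have hcont (y : EuclideanSpace ℝ (Fin (2 * m))) (hy : y ≠ 0) :
      ContinuousAt (fun y => |g y| ^ q) y := (hgc y hy).abs.rpow_const (Or.inr hq0.le)
  have hsupp : HasCompactSupport fun y => |g y| ^ q :=
    hcg.comp_left (g := fun t : ℝ => |t| ^ q) (by simp [hq0.ne'])
  refine ⟨q, hq1, integrable_of_integrableOn_ball hcont hsupp (half_pos hρ0) ?_⟩
  refine Integrable.mono' (g := fun x => M ^ q * Real.exp (q * c * D) *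
    (q * c / κ * J x + rieszKer s x)) ?_
    (aestronglyMeasurable_of_continuousAt hm hcont).restrict ?_
  · exact (((hJi.const_mul _).add (integrable_rieszKer hsm)).const_mul _).restrict
  filter_upwards [ae_restrict_mem measurableSet_ball, ae_restrict_of_ae (hae 0),
    ae_restrict_of_ae hslice] with x hx hx0 hxi
  rw [mem_ball_zero_iff] at hx
  have hxn : 0 < ‖x‖ := norm_pos_iff.2 hx0
  have hx2 : x ∈ ball (0 : EuclideanSpace ℝ (Fin (2 * m))) (1 / 2) := by
    rw [mem_ball_zero_iff]
    linarith
  have hgx := h0 x hx2 hx0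
  have h1 := exp_mul_setIntegral_log_le hm hg hcg (c := q * c) (by positivity) hκ (by linarith)
    (fun y hy => h0 y (ball_subset_ball (by linarith) hy)) hρ (hgc x hx0)
  have h2 := setIntegral_compl_log_le hg hs hρ0 hρ4 hx
  have hsplit : logPot g x = (∫ y in ball 0 ρ, g y * -Real.log ‖y - x‖) +
      ∫ y in (ball 0 ρ)ᶜ, g y * -Real.log ‖y - x‖ := by
    refine (integral_add_compl measurableSet_ball ?_).symm
    simpa using (integrable_mul_log_norm_sub (by omega) hg hcg (hgc x hx0)).neg
  have h3 : ‖x‖ ^ (-(a * q)) * ∫ y in ball 0 ρ, q * c / κ * g y * ‖y - x‖ ^ (-κ) ≤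
      q * c / κ * J x := by
    simp only [mul_assoc (q * c / κ)]
    rw [integral_const_mul, mul_left_comm]
    refine mul_le_mul_of_nonneg_left ?_ (by positivity)
    rw [← integral_const_mul, hJ]
    refine le_trans ?_ (setIntegral_le_integral (s := ball 0 ρ) hxi (Eventually.of_forall fun y =>
      mul_nonneg (abs_nonneg _) (add_nonneg (rieszKer_nonneg _ _) (rieszKer_nonneg _ _))))
    refine integral_mono_of_nonneg ?_ hxi.restrict ?_
    · filter_upwards [ae_restrict_mem measurableSet_ball, ae_restrict_of_ae (hae 0)] with y hy hy0
      have := h0 y (ball_subset_ball (by linarith) hy) hy0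
      simp only [Pi.zero_apply]
      positivity
    · filter_upwards [ae_restrict_mem measurableSet_ball, ae_restrict_of_ae (hae x)] with y hy hyx
      rw [mem_ball_zero_iff] at hy
      have h4 := norm_sub_le x y
      rw [rieszKer_of_norm_lt s (by linarith), rieszKer_of_norm_lt s (by linarith), mul_left_comm,
        norm_sub_rev y x]
      have h5 := rpow_neg_mul_rpow_neg_le hxn (norm_pos_iff.2 (sub_ne_zero.2 hyx.symm)) haq hκ.le
      have h6 := le_abs_self (g y)
      refine mul_le_mul h6 h5 (by positivity) (abs_nonneg _)
  have h4 : ‖x‖ ^ (-(a * q)) ≤ rieszKer s x := by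
    rw [rieszKer_of_norm_lt s (by linarith)]
    exact Real.rpow_le_rpow_of_exponent_ge hxn (by linarith) (by linarith)
  have hlog := Real.log_nonpos hxn.le (by linarith)
  rw [Real.norm_of_nonneg (by positivity), abs_of_nonneg hgx]
  calc g x ^ q ≤ (M * Real.exp (α * Real.log ‖x‖ + c * logPot g x)) ^ q := by
        gcongr
        exact hle x hx2 hx0
    _ = M ^ q * Real.exp ((α * Real.log ‖x‖ + c * logPot g x) * q) := by
        rw [Real.mul_rpow hM (Real.exp_pos _).le, ← Real.exp_mul]
    _ ≤ M ^ q * Real.exp (q * c * D + (Real.log ‖x‖ * -(a * q) +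
          q * c * ∫ y in ball 0 ρ, g y * -Real.log ‖y - x‖)) := by
        gcongr
        have h5 : (α + a) * q * Real.log ‖x‖ ≤ 0 :=
          mul_nonpos_of_nonneg_of_nonpos (mul_nonneg (by linarith) hq0.le) hlog
        have h6 := mul_le_mul_of_nonneg_left h2 (by positivity : 0 ≤ q * c)
        rw [hsplit]
        linarith
    _ = M ^ q * Real.exp (q * c * D) * (‖x‖ ^ (-(a * q)) *
          Real.exp (q * c * ∫ y in ball 0 ρ, g y * -Real.log ‖y - x‖)) := by
        rw [Real.exp_add, Real.exp_add, ← Real.rpow_def_of_pos hxn]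
        ring
    _ ≤ M ^ q * Real.exp (q * c * D) * (‖x‖ ^ (-(a * q)) *
          ((∫ y in ball 0 ρ, q * c / κ * g y * ‖y - x‖ ^ (-κ)) + 1)) := by
        gcongr
    _ ≤ _ := by
        gcongr
        rw [mul_add, mul_one]
        exact add_le_add h3 h4

end HigherIntegrability

section Holder

lemma abs_log_sub_log_le {γ a b : ℝ} (hγ : 0 < γ) (hγ1 : γ ≤ 1) (ha : 0 < a) (hb : 0 < b) :
    |Real.log a - Real.log b| ≤ γ⁻¹ * |a - b| ^ γ * (a ^ (-γ) + b ^ (-γ)) := by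
  wlog hab : b ≤ a generalizing a b
  · rw [abs_sub_comm, abs_sub_comm a b, add_comm (a ^ (-γ))]
    exact this hb ha (le_of_not_ge hab)
  have h1 : Real.log b ≤ Real.log a := Real.log_le_log hb hab
  have h0 : 0 ≤ (a - b) / b := div_nonneg (sub_nonneg.2 hab) hb.le
  have e : 1 + (a - b) / b = a / b := by field_simp; ring
  have h2 : Real.log a - Real.log b ≤ γ⁻¹ * ((a - b) / b) ^ γ := by
    have h3 := Real.rpow_add_le_add_rpow zero_le_one h0 hγ.le hγ1
    rw [Real.one_rpow, e] at h3
    have h4 := Real.log_le_sub_one_of_pos (by positivity : 0 < (a / b) ^ γ)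
    rw [Real.log_rpow (by positivity), Real.log_div ha.ne' hb.ne'] at h4
    rw [le_inv_mul_iff₀ hγ]
    linarith
  rw [abs_of_nonneg (sub_nonneg.2 h1), abs_of_nonneg (sub_nonneg.2 hab), mul_assoc]
  refine h2.trans ?_
  rw [Real.div_rpow (sub_nonneg.2 hab) hb.le, div_eq_mul_inv, ← Real.rpow_neg hb.le]
  have h5 : 0 ≤ a ^ (-γ) := by positivity
  have h6 : 0 ≤ (a - b) ^ γ := Real.rpow_nonneg (sub_nonneg.2 hab) γ
  gcongr
  linarith

lemma abs_log_le_rpow_neg {γ r : ℝ} (hγ : 0 < γ) (hr : 0 ≤ r) (hr1 : r ≤ 1) :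
    |Real.log r| ≤ γ⁻¹ * r ^ (-γ) := by
  have h := Real.log_le_rpow_div (inv_nonneg.2 hr) hγ
  rw [Real.log_inv, Real.inv_rpow hr, ← Real.rpow_neg hr] at h
  rw [abs_of_nonpos (Real.log_nonpos hr hr1)]
  refine h.trans_eq ?_
  ring

variable {m : ℕ}

/-- The logarithmic potential of a density in `L^q`, `q > 1`, is Hölder continuous. -/
theorem exists_holder_logPot (hm : 1 ≤ m) {g : EuclideanSpace ℝ (Fin (2 * m)) → ℝ}
    (hg : Integrable g) (hs : tsupport g ⊆ closedBall 0 (3 / 4)) {q : ℝ} (hq : 1 < q)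
    (hgq : Integrable fun y => |g y| ^ q) :
    ∃ γ B : ℝ, 0 < γ ∧ γ < 1 ∧ 0 ≤ B ∧ ∀ x ∈ ball 0 (1 / 4), ∀ x' ∈ ball 0 (1 / 4),
      |logPot g x - logPot g x'| ≤ B * ‖x - x'‖ ^ γ := by
  have hpq := Real.HolderConjugate.conjExponent hq
  set p := q.conjExponent
  have hp1 : 1 < p := hpq.symm.lt
  have hp0 : 0 < p := by linarith
  set γ := p⁻¹ with hγdef
  have hγ : 0 < γ := inv_pos.2 hp0
  have hγ1 : γ < 1 := inv_lt_one_of_one_lt₀ hp1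
  have h1m : (1 : ℝ) < (2 * m : ℕ) := by
    exact_mod_cast (by omega : 1 < 2 * m)
  have hk := integrable_rieszKer h1m
  have hsub (x : EuclideanSpace ℝ (Fin (2 * m))) (hx : x ∈ ball 0 (1 / 4))
      (y : EuclideanSpace ℝ (Fin (2 * m))) (hy : y ∈ tsupport g) : ‖y - x‖ < 1 := by
    have h1 := hs hy
    rw [mem_closedBall_zero_iff] at h1
    rw [mem_ball_zero_iff] at hx
    have := norm_sub_le y x
    linarith
  have hyoung (x : EuclideanSpace ℝ (Fin (2 * m))) (hx : x ∈ ball 0 (1 / 4))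
      (y : EuclideanSpace ℝ (Fin (2 * m))) :
      |g y| * ‖y - x‖ ^ (-γ) ≤ |g y| ^ q + rieszKer 1 (y - x) := by
    by_cases hy : y ∈ tsupport g
    · rw [rieszKer_of_norm_lt 1 (hsub x hx y hy)]
      have h := Real.young_inequality_of_nonneg (abs_nonneg (g y))
        (by positivity : 0 ≤ ‖y - x‖ ^ (-γ)) hpq
      rw [← Real.rpow_mul (norm_nonneg _), neg_mul, hγdef, inv_mul_cancel₀ hp0.ne'] at h
      refine h.trans (add_le_add (div_le_self (by positivity) hq.le)
        (div_le_self (by positivity) hp1.le))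
    · rw [image_eq_zero_of_notMem_tsupport hy, abs_zero, zero_mul]
      exact add_nonneg (by positivity) (rieszKer_nonneg _ _)
  have hmeas (x : EuclideanSpace ℝ (Fin (2 * m))) :
      AEStronglyMeasurable (fun y => |g y| * ‖y - x‖ ^ (-γ)) volume :=
    hg.abs.aestronglyMeasurable.mul ((by fun_prop : Measurable
      fun y : EuclideanSpace ℝ (Fin (2 * m)) => ‖y - x‖).pow_const (-γ)).aestronglyMeasurable
  have hi (x : EuclideanSpace ℝ (Fin (2 * m))) (hx : x ∈ ball 0 (1 / 4)) :
      Integrable fun y => |g y| * ‖y - x‖ ^ (-γ) := by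
    refine (hgq.add (hk.comp_sub_right x)).mono' (hmeas x) (Eventually.of_forall fun y => ?_)
    rw [Real.norm_of_nonneg (by positivity)]
    exact hyoung x hx y
  set A := (∫ y, |g y| ^ q) + ∫ y, (rieszKer 1 y : ℝ) ∂(volume : Measure
    (EuclideanSpace ℝ (Fin (2 * m)))) with hA
  have hA0 : 0 ≤ A := add_nonneg (integral_nonneg fun y => by positivity)
    (integral_nonneg fun y => rieszKer_nonneg _ _)
  have hbound (x : EuclideanSpace ℝ (Fin (2 * m))) (hx : x ∈ ball 0 (1 / 4)) :
      ∫ y, |g y| * ‖y - x‖ ^ (-γ) ≤ A := by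
    refine (integral_mono (hi x hx) (hgq.add (hk.comp_sub_right x)) (hyoung x hx)).trans_eq ?_
    rw [integral_add' hgq (hk.comp_sub_right x), integral_sub_right_eq_self, hA]
  have hilog (x : EuclideanSpace ℝ (Fin (2 * m))) (hx : x ∈ ball 0 (1 / 4)) :
      Integrable fun y => g y * -Real.log ‖y - x‖ := by
    refine ((hi x hx).const_mul γ⁻¹).mono' (hg.aestronglyMeasurable.mul
      (Real.measurable_log.comp (by fun_prop)).neg.aestronglyMeasurable)
      (Eventually.of_forall fun y => ?_)
    rw [norm_mul, norm_neg, Real.norm_eq_abs, Real.norm_eq_abs]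
    by_cases hy : y ∈ tsupport g
    · have := abs_log_le_rpow_neg hγ (norm_nonneg (y - x)) (hsub x hx y hy).le
      rw [mul_left_comm]
      gcongr
    · simp [image_eq_zero_of_notMem_tsupport hy]
  have : Nontrivial (EuclideanSpace ℝ (Fin (2 * m))) := by
    have : Nonempty (Fin (2 * m)) := ⟨⟨0, by omega⟩⟩
    infer_instance
  have hae (z : EuclideanSpace ℝ (Fin (2 * m))) :
      ∀ᵐ y : EuclideanSpace ℝ (Fin (2 * m)), y ≠ z :=
    (measure_eq_zero_iff_ae_notMem.1 (measure_singleton z)).mono fun y hy => by simpa using hy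
  refine ⟨γ, γ⁻¹ * (A + A), hγ, hγ1, by positivity, fun x hx x' hx' => ?_⟩
  rw [logPot, logPot, ← integral_sub (hilog x hx) (hilog x' hx')]
  have hmaj : ‖∫ y, (g y * -Real.log ‖y - x‖ - g y * -Real.log ‖y - x'‖)‖ ≤
      ∫ y, γ⁻¹ * ‖x - x'‖ ^ γ * (|g y| * ‖y - x‖ ^ (-γ) + |g y| * ‖y - x'‖ ^ (-γ)) := by
    refine norm_integral_le_of_norm_le (((hi x hx).add (hi x' hx')).const_mul _) ?_
    filter_upwards [hae x, hae x'] with y hy hy'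
    have h1 := abs_log_sub_log_le hγ hγ1.le (norm_pos_iff.2 (sub_ne_zero.2 hy))
      (norm_pos_iff.2 (sub_ne_zero.2 hy'))
    have h2 : |‖y - x‖ - ‖y - x'‖| ≤ ‖x - x'‖ := by
      refine (abs_norm_sub_norm_le _ _).trans_eq ?_
      rw [sub_sub_sub_cancel_left, norm_sub_rev]
    have h3 : |‖y - x‖ - ‖y - x'‖| ^ γ ≤ ‖x - x'‖ ^ γ := by gcongr
    have e : g y * -Real.log ‖y - x‖ - g y * -Real.log ‖y - x'‖ =
        -(g y * (Real.log ‖y - x‖ - Real.log ‖y - x'‖)) := by ring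
    rw [e, norm_neg, norm_mul, Real.norm_eq_abs, Real.norm_eq_abs, ← mul_add, mul_left_comm]
    refine mul_le_mul_of_nonneg_left (h1.trans ?_) (abs_nonneg _)
    gcongr
  rw [Real.norm_eq_abs, integral_const_mul, integral_add (hi x hx) (hi x' hx')] at hmaj
  refine hmaj.trans ?_
  have h4 := hbound x hx
  have h5 := hbound x' hx'
  rw [mul_right_comm]
  gcongr

lemma holderOnWith_of_norm_sub_le {E : Type*} [SeminormedAddCommGroup E] {f : E → ℝ} {s : Set E}
    {γ B : ℝ≥0} (h : ∀ x ∈ s, ∀ y ∈ s, |f x - f y| ≤ B * ‖x - y‖ ^ (γ : ℝ)) :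
    HolderOnWith B γ f s := by
  intro x hx y hy
  rw [edist_dist, edist_dist, Real.dist_eq, dist_eq_norm,
    ENNReal.ofReal_rpow_of_nonneg (norm_nonneg _) γ.coe_nonneg, ← ENNReal.ofReal_coe_nnreal,
    ← ENNReal.ofReal_mul B.coe_nonneg]
  exact ENNReal.ofReal_le_ofReal (h x hx y hy)

end Holder

end Singularity

/-- isolated singularity of the conformal Q-curvature equation
`(-Δ)^m u = K e^u` on the punctured unit ball in `ℝⁿ`, `n = 2m ≥ 4`. -/
theorem stmt_3 (m : ℕ) (hm : 2 ≤ m)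
    (K u : EuclideanSpace ℝ (Fin (2*m)) → ℝ)
    (hK0 : ∀ x ∈ ball (0 : EuclideanSpace ℝ (Fin (2*m))) 1, 0 ≤ K x)
    (hKbdd : ∃ M : ℝ, ∀ x ∈ ball (0 : EuclideanSpace ℝ (Fin (2*m))) 1, K x ≤ M)
    (hu : ContDiffOn ℝ (2*m : ℕ) u (ball (0 : EuclideanSpace ℝ (Fin (2*m))) 1 \ {0}))
    (heq : ∀ x ∈ ball (0 : EuclideanSpace ℝ (Fin (2*m))) 1 \ {0},
      nlapIter m u x = K x * Real.exp (u x))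
    (hint : IntegrableOn (fun x => Real.exp (u x))
      (ball (0 : EuclideanSpace ℝ (Fin (2*m))) 1 \ {0}))
    (hlittleo : ∀ ε > (0 : ℝ), ∃ δ > (0 : ℝ), ∀ r : ℝ, 0 < r → r < δ →
      ∫⁻ x in ball (0 : EuclideanSpace ℝ (Fin (2*m))) r \ {0}, (‖u x‖₊ : ℝ≥0∞)
        ≤ ENNReal.ofReal (ε * r ^ (2*m - 2))) :
    ∃ α : ℝ, α > -(2*m : ℝ) ∧ ∃ γ : NNReal, 0 < γ ∧ γ < 1 ∧
      ∃ ε > (0 : ℝ), ∃ φ : EuclideanSpace ℝ (Fin (2*m)) → ℝ,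
        (∃ C : NNReal, HolderOnWith C γ φ (ball (0 : EuclideanSpace ℝ (Fin (2*m))) ε)) ∧
        ∀ x ∈ ball (0 : EuclideanSpace ℝ (Fin (2*m))) ε \ {0},
          u x = α * Real.log ‖x‖ + φ x := by
  obtain ⟨M, hM⟩ := hKbdd
  have hm1 : 1 ≤ m := by omega
  obtain ⟨g, α, hα, hg, hs, hgc, hgb, hrep⟩ :=
    exists_eq_mul_log_add_logPot hm1 hK0 hM hu heq hint hlittleo
  have hc : 0 < (logConst m)⁻¹ := inv_pos.2 (logConst_pos hm1)
  obtain ⟨q, hq, hgq⟩ := exists_integrable_rpow hm1 hg hs hgc (abs_nonneg M) hα hc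
    (fun y hy hy0 => (hgb y hy hy0).1) fun y hy hy0 => by
      rw [← hrep y hy hy0]
      exact (hgb y hy hy0).2
  obtain ⟨γ, B, hγ, hγ1, hB, hH⟩ := exists_holder_logPot hm1 hg hs hq hgq
  lift γ to ℝ≥0 using hγ.le
  lift B to ℝ≥0 using hB
  refine ⟨α, hα, γ, hγ, hγ1, 1 / 4, by norm_num, fun x => (logConst m)⁻¹ * logPot g x,
    ⟨Real.toNNReal (logConst m)⁻¹ * B, holderOnWith_of_norm_sub_le fun x hx y hy => ?_⟩,
    fun x hx => hrep x (ball_subset_ball (by norm_num) hx.1) hx.2⟩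
  rw [← mul_sub, abs_mul, abs_of_pos hc, NNReal.coe_mul, Real.coe_toNNReal _ hc.le, mul_assoc]
  exact mul_le_mul_of_nonneg_left (hH x hx y hy) hc.le

end
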